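/- arXiv:1703.03299 — 3 statements merged into one kernel-verified Lean document; each statement's English description precedes it below -/
import Mathlib

section
/- (Weighted fractional Sobolev inequality) Let N ≥ 2 be an integer, 0 < s < 1 and p > 1 with ps < N, and let β satisfy −ps < β < (N−ps)/2. Set p*_s = pN/(N−ps). There exists a positive constant S(N,s,β) such that for all v ∈ C_c^∞(ℝ^N): ∬_{ℝ^N×ℝ^N} |v(x)−v(y)|^p / ( |x−y|^{N+ps} |x|^β |y|^β ) dx dy ≥ S(N,s,β) · ( ∫_{ℝ^N} |v(x)|^{p*_s} / |x|^{2β p*_s / p} dx )^{p/p*_s}. -/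
open MeasureTheory Real Set Filter Metric
open scoped ENNReal Topology NNReal

noncomputable section

abbrev Euc (N : ℕ) := EuclideanSpace ℝ (Fin N)

/-- The weighted Gagliardo energy
`∬ |u(x)-u(y)|^p / (|x-y|^{N+ps} |x|^β |y|^β) dx dy` (valued in `ℝ≥0∞`). -/
def weightedGagliardoEnergy (N : ℕ) (p s β : ℝ) (u : Euc N → ℝ) : ℝ≥0∞ :=
  ∫⁻ x, ∫⁻ y, ENNReal.ofReal
    (|u x - u y| ^ p / (‖x - y‖ ^ ((N : ℝ) + p * s) * ‖x‖ ^ β * ‖y‖ ^ β))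


/-- The integrand of the weighted Gagliardo energy, with `d = N + ps`. -/
def gagliardoKernel {N : ℕ} (p d β : ℝ) (u : Euc N → ℝ) (x y : Euc N) : ℝ :=
  |u x - u y| ^ p / (‖x - y‖ ^ d * ‖x‖ ^ β * ‖y‖ ^ β)

/-- The weighted power `|u|^q / |x|^α`. -/
def weightedPower {N : ℕ} (q α : ℝ) (u : Euc N → ℝ) (x : Euc N) : ℝ :=
  |u x| ^ q / ‖x‖ ^ α

/-- The volume of the unit ball. -/
def unitBallVolume (N : ℕ) : ℝ := (volume (ball (0 : Euc N) 1)).toReal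

lemma unitBallVolume_pos (N : ℕ) : 0 < unitBallVolume N :=
  ENNReal.toReal_pos (measure_ball_pos _ _ one_pos).ne' measure_ball_lt_top.ne

lemma volume_euc_ball {N : ℕ} (z : Euc N) {r : ℝ} (hr : 0 < r) :
    volume (ball z r) = ENNReal.ofReal (unitBallVolume N * r ^ (N : ℝ)) := by
  rw [Measure.addHaar_ball_of_pos _ _ hr, finrank_euclideanSpace_fin, rpow_natCast,
    mul_comm (unitBallVolume N), ENNReal.ofReal_mul (by positivity), unitBallVolume,
    ENNReal.ofReal_toReal measure_ball_lt_top.ne]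

lemma volume_euc_closedBall {N : ℕ} (z : Euc N) {r : ℝ} (hr : 0 < r) :
    volume (closedBall z r) = ENNReal.ofReal (unitBallVolume N * r ^ (N : ℝ)) := by
  rw [Measure.addHaar_closedBall _ _ hr.le, finrank_euclideanSpace_fin, rpow_natCast,
    mul_comm (unitBallVolume N), ENNReal.ofReal_mul (by positivity), unitBallVolume,
    ENNReal.ofReal_toReal measure_ball_lt_top.ne]

lemma rpow_le_three_rpow_abs_mul {t u : ℝ} (γ : ℝ) (hu : 0 < u) (h1 : u / 3 ≤ t)
    (h2 : t ≤ 3 * u) : t ^ γ ≤ 3 ^ |γ| * u ^ γ := by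
  have ht : 0 < t := by linarith
  rcases le_total 0 γ with h | h
  · rw [abs_of_nonneg h, ← mul_rpow (by norm_num) hu.le]
    exact rpow_le_rpow ht.le h2 h
  · calc t ^ γ ≤ (u / 3) ^ γ := rpow_le_rpow_of_nonpos (by positivity) h1 h
      _ = 3 ^ |γ| * u ^ γ := by
        rw [abs_of_nonpos h, div_rpow hu.le (by norm_num), rpow_neg (by norm_num)]
        field_simp

section Pointwise

variable {N : ℕ} {p d β q α θ : ℝ} {u : Euc N → ℝ}

lemma gagliardoKernel_nonneg (x y : Euc N) : 0 ≤ gagliardoKernel p d β u x y := by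
  unfold gagliardoKernel; positivity

lemma weightedPower_nonneg (x : Euc N) : 0 ≤ weightedPower q α u x := by
  unfold weightedPower; positivity

lemma measurable_weightedPower (hu : Continuous u) : Measurable (weightedPower q α u) := by
  have := hu.measurable
  unfold weightedPower
  fun_prop

lemma one_le_weightedPower_add_gagliardoKernel (hp : 0 < p) (hq : 0 < q) (hd : 0 < d)
    (hqθ : q * θ = p) (hαθ : α * θ = 2 * β) {x y : Euc N} {a b R : ℝ}
    (hx : x ≠ 0) (hy : y ≠ 0) (hux : u x ≠ 0)
    (ha : ‖y‖ ^ β ≤ a * ‖x‖ ^ β) (hb : ‖y‖ ^ α ≤ b * ‖x‖ ^ α) (hR : ‖x - y‖ ≤ R) :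
    1 ≤ 2 ^ q * b / weightedPower q α u x * weightedPower q α u y +
      2 ^ p * R ^ d * a / weightedPower q α u x ^ θ * gagliardoKernel p d β u x y := by
  have hx' : 0 < ‖x‖ := norm_pos_iff.2 hx
  have hy' : 0 < ‖y‖ := norm_pos_iff.2 hy
  have ht : 0 < |u x| := abs_pos.2 hux
  have hxβ := rpow_pos_of_pos hx' β
  have hxα := rpow_pos_of_pos hx' α
  have hyβ := rpow_pos_of_pos hy' β
  have hyα := rpow_pos_of_pos hy' α
  have ha0 : 0 < a := by
    by_contra h
    nlinarith
  have hb0 : 0 < b := by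
    by_contra h
    nlinarith
  have hR0 : 0 ≤ R := (norm_nonneg _).trans hR
  have hW0 : 0 < weightedPower q α u x := by unfold weightedPower; positivity
  by_cases h : |u x| ≤ 2 * |u y|
  · refine le_add_of_le_of_nonneg ?_
      (mul_nonneg (by positivity) (gagliardoKernel_nonneg x y))
    have h1 : |u x| ^ q ≤ 2 ^ q * |u y| ^ q := by
      rw [← mul_rpow (by norm_num) (abs_nonneg _)]
      exact rpow_le_rpow ht.le h hq.le
    rw [div_mul_eq_mul_div, one_le_div hW0]
    unfold weightedPower
    rw [mul_div_assoc', div_le_div_iff₀ hxα hyα]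
    calc |u x| ^ q * ‖y‖ ^ α ≤ (2 ^ q * |u y| ^ q) * (b * ‖x‖ ^ α) := by gcongr
      _ = _ := by ring
  · push Not at h
    refine le_add_of_nonneg_of_le
      (mul_nonneg (by positivity) (weightedPower_nonneg y)) ?_
    have h0 : |u x| ≤ 2 * |u x - u y| := by
      have := abs_sub_abs_le_abs_sub (u x) (u y)
      linarith
    have hxy : x ≠ y := by
      rintro rfl
      simp at h0
      exact hux h0
    have hxy' : 0 < ‖x - y‖ := norm_pos_iff.2 (sub_ne_zero.2 hxy)
    have h1 : |u x| ^ p ≤ 2 ^ p * |u x - u y| ^ p := by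
      rw [← mul_rpow (by norm_num) (abs_nonneg _)]
      exact rpow_le_rpow ht.le h0 hp.le
    have hθ : weightedPower q α u x ^ θ = |u x| ^ p / (‖x‖ ^ β * ‖x‖ ^ β) := by
      unfold weightedPower
      rw [div_rpow (by positivity) (by positivity), ← rpow_mul ht.le, ← rpow_mul hx'.le, hqθ,
        hαθ, two_mul, rpow_add hx']
    have h2 : ‖x - y‖ ^ d ≤ R ^ d := rpow_le_rpow hxy'.le hR hd.le
    rw [div_mul_eq_mul_div, one_le_div (by positivity), hθ]
    unfold gagliardoKernel
    have hK : 0 < ‖x - y‖ ^ d := rpow_pos_of_pos hxy' d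
    rw [mul_div_assoc', div_le_div_iff₀ (by positivity) (by positivity)]
    calc |u x| ^ p * (‖x - y‖ ^ d * ‖x‖ ^ β * ‖y‖ ^ β)
        ≤ (2 ^ p * |u x - u y| ^ p) * (R ^ d * ‖x‖ ^ β * (a * ‖x‖ ^ β)) := by gcongr
      _ = _ := by ring

lemma weightedPower_ball_dichotomy (hu : Continuous u) (hp : 0 < p) (hq : 0 < q) (hd : 0 < d)
    (hqθ : q * θ = p) (hαθ : α * θ = 2 * β) {x z : Euc N} {a b R r : ℝ} (hx : x ≠ 0)
    (hr : 0 < r) (ha0 : 0 ≤ a) (hb0 : 0 ≤ b) (hR0 : 0 ≤ R)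
    (hy : ∀ y ∈ ball z r, y ≠ 0)
    (ha : ∀ y ∈ ball z r, ‖y‖ ^ β ≤ a * ‖x‖ ^ β)
    (hb : ∀ y ∈ ball z r, ‖y‖ ^ α ≤ b * ‖x‖ ^ α)
    (hR : ∀ y ∈ ball z r, ‖x - y‖ ≤ R) {A e : ℝ} (hA0 : 0 ≤ A) (he0 : 0 ≤ e)
    (hA : ∫⁻ y in ball z r, ENNReal.ofReal (weightedPower q α u y) ≤ ENNReal.ofReal A)
    (he : ∫⁻ y, ENNReal.ofReal (gagliardoKernel p d β u x y) ≤ ENNReal.ofReal e) :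
    unitBallVolume N * r ^ (N : ℝ) * weightedPower q α u x ≤ 2 * (2 ^ q * b * A) ∨
      unitBallVolume N * r ^ (N : ℝ) * weightedPower q α u x ^ θ ≤
        2 * (2 ^ p * R ^ d * a * e) := by
  have hc := unitBallVolume_pos N
  by_cases hux : u x = 0
  · left
    have : weightedPower q α u x = 0 := by
      simp [weightedPower, hux, zero_rpow hq.ne']
    rw [this]
    simp only [mul_zero]
    positivity
  have hx' : 0 < ‖x‖ := norm_pos_iff.2 hx
  have hW0 : 0 < weightedPower q α u x := by
    have : 0 < |u x| := abs_pos.2 hux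
    unfold weightedPower; positivity
  have hWθ := rpow_pos_of_pos hW0 θ
  set w := weightedPower q α u x with hw
  have key : unitBallVolume N * r ^ (N : ℝ) ≤
      2 ^ q * b / w * A + 2 ^ p * R ^ d * a / w ^ θ * e := by
    rw [← ENNReal.ofReal_le_ofReal_iff (by positivity), ← volume_euc_ball z hr,
      ENNReal.ofReal_add (by positivity) (by positivity), ENNReal.ofReal_mul (by positivity),
      ENNReal.ofReal_mul (by positivity)]
    calc volume (ball z r) = ∫⁻ y in ball z r, 1 := by simp
      _ ≤ ∫⁻ y in ball z r,
            (ENNReal.ofReal (2 ^ q * b / w) * ENNReal.ofReal (weightedPower q α u y) +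
            ENNReal.ofReal (2 ^ p * R ^ d * a / w ^ θ) *
              ENNReal.ofReal (gagliardoKernel p d β u x y)) := by
          refine setLIntegral_mono' measurableSet_ball fun y hyb => ?_
          have h1 := weightedPower_nonneg (q := q) (α := α) (u := u) y
          have h2 := gagliardoKernel_nonneg (p := p) (d := d) (β := β) (u := u) x y
          rw [← ENNReal.ofReal_mul (by positivity), ← ENNReal.ofReal_mul (by positivity),
            ← ENNReal.ofReal_add (by positivity) (by positivity), ENNReal.one_le_ofReal]
          exact one_le_weightedPower_add_gagliardoKernel hp hq hd hqθ hαθ hx (hy y hyb) hux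
            (ha y hyb) (hb y hyb) (hR y hyb)
      _ = ENNReal.ofReal (2 ^ q * b / w) *
            (∫⁻ y in ball z r, ENNReal.ofReal (weightedPower q α u y)) +
          ENNReal.ofReal (2 ^ p * R ^ d * a / w ^ θ) *
            (∫⁻ y in ball z r, ENNReal.ofReal (gagliardoKernel p d β u x y)) := by
          rw [lintegral_add_left
            ((measurable_weightedPower hu).ennreal_ofReal.const_mul _),
            lintegral_const_mul' _ _ ENNReal.ofReal_ne_top,
            lintegral_const_mul' _ _ ENNReal.ofReal_ne_top]
      _ ≤ _ := by
          gcongr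
          exact (setLIntegral_le_lintegral _ _).trans he
  by_contra! hcon
  obtain ⟨h1, h2⟩ := hcon
  have h1' : 2 ^ q * b / w * A < unitBallVolume N * r ^ (N : ℝ) / 2 := by
    rw [div_mul_eq_mul_div, div_lt_iff₀ hW0]; linarith
  have h2' : 2 ^ p * R ^ d * a / w ^ θ * e < unitBallVolume N * r ^ (N : ℝ) / 2 := by
    rw [div_mul_eq_mul_div, div_lt_iff₀ hWθ]; linarith
  linarith

end Pointwise

lemma le_of_rpow_le_mul_rpow {w C r n θ e G : ℝ} (hw : 0 ≤ w) (hC : 0 ≤ C) (hr : 0 ≤ r)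
    (hθ : 0 < θ) (hθ1 : θ ≤ 1) (he : 0 ≤ e) (hG : 0 ≤ G)
    (hw1 : w ^ θ ≤ C * r ^ (n * (1 - θ)) * e) (h : r ^ n * e ≤ G ^ θ) :
    w ≤ C ^ θ⁻¹ * G ^ (1 - θ) * e := by
  rw [← rpow_le_rpow_iff hw (by positivity) hθ]
  have h1 : (r ^ n * e) ^ (1 - θ) ≤ (G ^ θ) ^ (1 - θ) :=
    rpow_le_rpow (by positivity) h (by linarith)
  have h2 : (e : ℝ) = e ^ (1 - θ) * e ^ θ := by
    rcases he.eq_or_lt with rfl | he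
    · simp [zero_rpow hθ.ne']
    · rw [← rpow_add he]; simp
  calc w ^ θ ≤ C * r ^ (n * (1 - θ)) * e := hw1
    _ = C * (r ^ n * e) ^ (1 - θ) * e ^ θ := by
      rw [mul_rpow (by positivity) he, ← rpow_mul hr]
      nth_rewrite 1 [h2]
      ring
    _ ≤ C * (G ^ θ) ^ (1 - θ) * e ^ θ := by gcongr
    _ = (C ^ θ⁻¹ * G ^ (1 - θ) * e) ^ θ := by
      rw [mul_rpow (by positivity) he, mul_rpow (by positivity) (by positivity),
        rpow_inv_rpow hC hθ.ne', ← rpow_mul hG, ← rpow_mul hG, mul_comm θ]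

lemma exists_weightedPower_le {N : ℕ} {p d β q α θ M : ℝ} (hN : 0 < N) (hp : 0 < p) (hq : 0 < q)
    (hθ : 0 < θ) (hθ1 : θ ≤ 1) (hqθ : q * θ = p) (hαθ : α * θ = 2 * β)
    (hd : d = N + N * (1 - θ)) (hM : 1 ≤ M) :
    ∃ C : ℝ, 0 < C ∧ ∀ u : Euc N → ℝ, Continuous u → ∀ x : Euc N, x ≠ 0 → ∀ G e A : ℝ,
      0 < G → 0 ≤ e → 0 ≤ A →
      ∫⁻ y, ENNReal.ofReal (weightedPower q α u y) ≤ ENNReal.ofReal G →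
      ∫⁻ y, ENNReal.ofReal (gagliardoKernel p d β u x y) ≤ ENNReal.ofReal e →
      ∫⁻ y in ball ((2 * M) • x) (M * ‖x‖), ENNReal.ofReal (weightedPower q α u y) ≤
        ENNReal.ofReal A →
      weightedPower q α u x ≤ C * G ^ (1 - θ) * e +
        2 * 2 ^ q * 3 ^ |α| / unitBallVolume N * M ^ (α - N) * (‖x‖ ^ (N : ℝ))⁻¹ * A := by
  have hn : (0 : ℝ) < N := by exact_mod_cast hN
  have hd0 : 0 < d := by
    have : 0 ≤ N * (1 - θ) := mul_nonneg hn.le (by linarith)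
    linarith
  have hM0 : 0 < M := by linarith
  have hc := unitBallVolume_pos N
  set c := unitBallVolume N
  set n : ℝ := (N : ℝ)
  set C₁ : ℝ := 2 * 2 ^ q * 3 ^ |α| * 2 ^ n / c with hC₁
  set C₂ : ℝ := 2 * 2 ^ p * 3 ^ |β| / c with hC₂
  set C₃ : ℝ := 2 * 2 ^ p * (4 * M) ^ d * (3 ^ |β| * M ^ β) / (c * M ^ n) with hC₃
  have hC₁0 : 0 < C₁ := by positivity
  have hC₂0 : 0 < C₂ := by positivity
  have hC₃0 : 0 < C₃ := by positivity
  have hC₂θ : 0 < C₂ ^ θ⁻¹ := by positivity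
  have hC₃θ : 0 < C₃ ^ θ⁻¹ := by positivity
  refine ⟨C₁ + C₂ ^ θ⁻¹ + C₃ ^ θ⁻¹, by positivity, ?_⟩
  intro u hu x hx G e A hG he hA hGle hele hAle
  have hx' : 0 < ‖x‖ := norm_pos_iff.2 hx
  have hW := weightedPower_nonneg (q := q) (α := α) (u := u) x
  have hT : 0 ≤ G ^ (1 - θ) * e := by positivity
  have hsecond : 0 ≤ 2 * 2 ^ q * 3 ^ |α| / c * M ^ (α - n) * (‖x‖ ^ n)⁻¹ * A := by positivity
  have hmain : weightedPower q α u x ≤ C₁ * (G ^ (1 - θ) * e) ∨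
      weightedPower q α u x ≤ C₂ ^ θ⁻¹ * (G ^ (1 - θ) * e) ∨
      weightedPower q α u x ≤ C₃ ^ θ⁻¹ * (G ^ (1 - θ) * e) ∨
      weightedPower q α u x ≤ 2 * 2 ^ q * 3 ^ |α| / c * M ^ (α - n) * (‖x‖ ^ n)⁻¹ * A := by
    rcases lt_or_ge (G ^ θ) (‖x‖ ^ n * e) with hgood | hbad
    · have he' : 0 < e := by
        by_contra h
        have : e = 0 := le_antisymm (not_lt.1 h) he
        have : 0 < G ^ θ := by positivity
        simp_all
        linarith
      have hGe : 0 < G ^ θ / e := by positivity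
      set r₀ : ℝ := (G ^ θ / e) ^ n⁻¹ with hr₀
      have hr₀0 : 0 < r₀ := by positivity
      have hr₀n : r₀ ^ n * e = G ^ θ := by
        rw [hr₀, rpow_inv_rpow hGe.le hn.ne']
        field_simp
      have hr₀x : r₀ ≤ ‖x‖ := by
        rw [← rpow_le_rpow_iff hr₀0.le hx'.le hn]
        nlinarith
      have hball : ∀ y ∈ ball x (r₀ / 2), ‖x‖ / 3 ≤ ‖y‖ ∧ ‖y‖ ≤ 3 * ‖x‖ ∧ ‖x - y‖ ≤ r₀ / 2 := by
        intro y hy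
        rw [mem_ball, dist_comm, dist_eq_norm] at hy
        have h1 := norm_sub_norm_le x y
        have h2 := norm_sub_norm_le y x
        rw [norm_sub_rev y x] at h2
        exact ⟨by linarith, by linarith, hy.le⟩
      rcases weightedPower_ball_dichotomy (β := β) (z := x) (a := 3 ^ |β|) (b := 3 ^ |α|)
        (R := r₀ / 2) (r := r₀ / 2) hu hp hq hd0 hqθ hαθ hx
        (by positivity) (by positivity) (by positivity) (by positivity)
        (fun y hy => norm_pos_iff.1 (by linarith [(hball y hy).1]))
        (fun y hy => rpow_le_three_rpow_abs_mul β hx' (hball y hy).1 (hball y hy).2.1)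
        (fun y hy => rpow_le_three_rpow_abs_mul α hx' (hball y hy).1 (hball y hy).2.1)
        (fun y hy => (hball y hy).2.2) hG.le he ((setLIntegral_le_lintegral _ _).trans hGle) hele
        with h | h
      · left
        rw [div_rpow hr₀0.le (by norm_num)] at h
        have hGθ : 0 < G ^ θ := by positivity
        have hGs : G = G ^ θ * G ^ (1 - θ) := by rw [← rpow_add hG]; simp
        rw [← mul_le_mul_iff_of_pos_left hGθ]
        have h2n : (0 : ℝ) < 2 ^ n := by positivity
        calc G ^ θ * weightedPower q α u x
            = (c * (r₀ ^ n / 2 ^ n) * weightedPower q α u x) * (2 ^ n * e / c) := by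
              rw [← hr₀n]; field_simp
          _ ≤ (2 * (2 ^ q * 3 ^ |α| * G)) * (2 ^ n * e / c) := by gcongr
          _ = C₁ * G * e := by rw [hC₁]; field_simp
          _ = G ^ θ * (C₁ * (G ^ (1 - θ) * e)) := by
              nth_rewrite 1 [hGs]; ring
      · right; left
        rw [← mul_assoc]
        refine le_of_rpow_le_mul_rpow (r := r₀ / 2) (n := n) hW hC₂0.le (by positivity) hθ hθ1 he
          hG.le ?_ ?_
        · rw [hd, rpow_add (by positivity)] at h
          have hrn : 0 < c * (r₀ / 2) ^ n := by positivity
          rw [← mul_le_mul_iff_of_pos_left hrn]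
          refine h.trans_eq ?_
          rw [hC₂]
          field_simp
        · rw [← hr₀n]
          gcongr
          linarith
    · have hball : ∀ y ∈ ball ((2 * M) • x) (M * ‖x‖),
          M * ‖x‖ ≤ ‖y‖ ∧ ‖y‖ ≤ 3 * (M * ‖x‖) ∧ ‖x - y‖ ≤ 4 * M * ‖x‖ := by
        intro y hy
        rw [mem_ball, dist_comm, dist_eq_norm] at hy
        have h1 := norm_sub_norm_le ((2 * M) • x) y
        have h2 := norm_sub_norm_le y ((2 * M) • x)
        rw [norm_sub_rev y] at h2
        have h3 : ‖(2 * M) • x‖ = 2 * M * ‖x‖ := by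
          rw [norm_smul, norm_of_nonneg (by positivity)]
        have h4 := norm_sub_le x y
        have h5 : ‖y‖ ≤ 3 * (M * ‖x‖) := by linarith
        exact ⟨by linarith, h5, by nlinarith⟩
      have hMx : 0 < M * ‖x‖ := by positivity
      rcases weightedPower_ball_dichotomy (β := β) (z := (2 * M) • x) (a := 3 ^ |β| * M ^ β)
        (b := 3 ^ |α| * M ^ α) (R := 4 * M * ‖x‖) (r := M * ‖x‖) hu hp hq hd0 hqθ hαθ hx
        (by positivity) (by positivity) (by positivity) (by positivity)
        (fun y hy => norm_pos_iff.1 (by linarith [(hball y hy).1]))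
        (fun y hy => by
          rw [mul_assoc, ← mul_rpow hM0.le hx'.le]
          exact rpow_le_three_rpow_abs_mul β hMx (by linarith [(hball y hy).1]) (hball y hy).2.1)
        (fun y hy => by
          rw [mul_assoc, ← mul_rpow hM0.le hx'.le]
          exact rpow_le_three_rpow_abs_mul α hMx (by linarith [(hball y hy).1]) (hball y hy).2.1)
        (fun y hy => (hball y hy).2.2) hA he hAle hele with h | h
      · right; right; right
        rw [mul_rpow hM0.le hx'.le] at h
        have hrn : 0 < c * (M ^ n * ‖x‖ ^ n) := by positivity
        rw [← mul_le_mul_iff_of_pos_left hrn]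
        refine h.trans_eq ?_
        rw [rpow_sub hM0]
        field_simp
      · right; right; left
        rw [← mul_assoc]
        refine le_of_rpow_le_mul_rpow (r := ‖x‖) (n := n) hW hC₃0.le (by positivity) hθ hθ1 he
          hG.le ?_ hbad
        rw [mul_rpow hM0.le hx'.le, mul_rpow (by positivity) hx'.le, hd, rpow_add hx', ← hd] at h
        have hrn : 0 < c * (M ^ n * ‖x‖ ^ n) := by positivity
        rw [← mul_le_mul_iff_of_pos_left hrn]
        refine h.trans_eq ?_
        rw [hC₃]
        field_simp
  have hp1 := mul_nonneg hC₁0.le hT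
  have hp2 := mul_nonneg hC₂θ.le hT
  have hp3 := mul_nonneg hC₃θ.le hT
  have hexp : (C₁ + C₂ ^ θ⁻¹ + C₃ ^ θ⁻¹) * G ^ (1 - θ) * e = C₁ * (G ^ (1 - θ) * e) +
      C₂ ^ θ⁻¹ * (G ^ (1 - θ) * e) + C₃ ^ θ⁻¹ * (G ^ (1 - θ) * e) := by ring
  rw [hexp]
  rcases hmain with h | h | h | h <;> linarith

/-- Averaging over dilated balls is bounded on `L¹`, uniformly in the dilation factor. -/
lemma lintegral_ball_average_le {N : ℕ} (hN : 0 < N) {M : ℝ} (hM : 0 < M)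
    {f : Euc N → ℝ≥0∞} (hf : Measurable f) :
    ∫⁻ x : Euc N, ENNReal.ofReal ((‖x‖ ^ (N : ℝ))⁻¹) * ∫⁻ y in ball ((2 * M) • x) (M * ‖x‖), f y ≤
      ENNReal.ofReal (3 ^ (N : ℝ) * unitBallVolume N) * ∫⁻ y, f y := by
  have : Nonempty (Fin N) := ⟨⟨0, hN⟩⟩
  have : Nontrivial (Euc N) := inferInstance
  have hc := unitBallVolume_pos N
  set S : Set (Euc N × Euc N) := {z | M * ‖z.1‖ ≤ ‖z.2‖ ∧ ‖z.2‖ ≤ 3 * (M * ‖z.1‖)} with hS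
  have hSm : MeasurableSet S := by
    have h1 : MeasurableSet {z : Euc N × Euc N | M * ‖z.1‖ ≤ ‖z.2‖} :=
      measurableSet_le (by fun_prop) (by fun_prop)
    have h2 : MeasurableSet {z : Euc N × Euc N | ‖z.2‖ ≤ 3 * (M * ‖z.1‖)} :=
      measurableSet_le (by fun_prop) (by fun_prop)
    exact h1.inter h2
  set F : Euc N → Euc N → ℝ≥0∞ := fun x y =>
    S.indicator (fun z => ENNReal.ofReal ((‖z.1‖ ^ (N : ℝ))⁻¹) * f z.2) (x, y) with hF
  have hFm : Measurable (Function.uncurry F) := by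
    have : Measurable fun z : Euc N × Euc N =>
        ENNReal.ofReal ((‖z.1‖ ^ (N : ℝ))⁻¹) * f z.2 := by fun_prop
    exact this.indicator hSm
  calc ∫⁻ x : Euc N, ENNReal.ofReal ((‖x‖ ^ (N : ℝ))⁻¹) *
        ∫⁻ y in ball ((2 * M) • x) (M * ‖x‖), f y
      ≤ ∫⁻ x, ∫⁻ y, F x y := by
        refine lintegral_mono fun x => ?_
        rw [← lintegral_const_mul' _ _ ENNReal.ofReal_ne_top,
          ← lintegral_indicator measurableSet_ball]
        refine lintegral_mono fun y => ?_
        by_cases hy : y ∈ ball ((2 * M) • x) (M * ‖x‖)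
        · have hmem : (x, y) ∈ S := by
            rw [mem_ball, dist_comm, dist_eq_norm] at hy
            have h1 := norm_sub_norm_le ((2 * M) • x) y
            have h2 := norm_sub_norm_le y ((2 * M) • x)
            rw [norm_sub_rev y] at h2
            have h3 : ‖(2 * M) • x‖ = 2 * M * ‖x‖ := by
              rw [norm_smul, norm_of_nonneg (by positivity)]
            simp only [hS, mem_ofPred_eq]
            exact ⟨by linarith, by linarith⟩
          simp [hF, hmem, hy]
        · simp [hy]
    _ = ∫⁻ y, ∫⁻ x, F x y := lintegral_lintegral_swap hFm.aemeasurable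
    _ ≤ ∫⁻ y, ENNReal.ofReal (3 ^ (N : ℝ) * unitBallVolume N) * f y := by
        refine lintegral_mono_ae ?_
        filter_upwards [Measure.ae_ne volume (0 : Euc N)] with y hy
        have hy' : 0 < ‖y‖ := norm_pos_iff.2 hy
        calc ∫⁻ x, F x y
            ≤ ∫⁻ x, (closedBall (0 : Euc N) (‖y‖ / M)).indicator
                (fun _ => ENNReal.ofReal ((3 * M / ‖y‖) ^ (N : ℝ)) * f y) x := by
              refine lintegral_mono fun x => ?_
              by_cases hxy : (x, y) ∈ S
              · have hxy' := hxy
                simp only [hS, mem_ofPred_eq] at hxy'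
                obtain ⟨h1, h2⟩ := hxy'
                have hx' : 0 < ‖x‖ := by
                  by_contra h
                  have : ‖x‖ = 0 := le_antisymm (not_lt.1 h) (norm_nonneg _)
                  rw [this] at h2
                  linarith
                have hmem : x ∈ closedBall (0 : Euc N) (‖y‖ / M) := by
                  rw [mem_closedBall_zero_iff, le_div_iff₀ hM]
                  linarith
                simp only [hF, indicator_of_mem hxy, indicator_of_mem hmem]
                gcongr
                rw [← inv_rpow hx'.le]
                gcongr
                rw [inv_eq_one_div, div_le_div_iff₀ hx' hy']
                linarith
              · simp [hF, indicator_of_notMem hxy]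
          _ = ENNReal.ofReal ((3 * M / ‖y‖) ^ (N : ℝ)) * f y *
                ENNReal.ofReal (unitBallVolume N * (‖y‖ / M) ^ (N : ℝ)) := by
              rw [lintegral_indicator measurableSet_closedBall, setLIntegral_const,
                volume_euc_closedBall _ (by positivity)]
          _ = ENNReal.ofReal (3 ^ (N : ℝ) * unitBallVolume N) * f y := by
              rw [mul_right_comm, ← ENNReal.ofReal_mul (by positivity)]
              congr 2
              rw [mul_left_comm, ← mul_rpow (by positivity) (by positivity), mul_comm]
              congr 2
              field_simp
    _ = _ := lintegral_const_mul _ hf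

lemma exists_rpow_lintegral_weightedPower_le {N : ℕ} {p d β q α θ : ℝ} (hN : 0 < N) (hp : 0 < p)
    (hq : 0 < q) (hθ : 0 < θ) (hθ1 : θ ≤ 1) (hqθ : q * θ = p) (hαθ : α * θ = 2 * β)
    (hd : d = N + N * (1 - θ)) (hα : α < N) :
    ∃ C : ℝ, 0 < C ∧ ∀ u : Euc N → ℝ, Continuous u → ∀ G : ℝ, 0 < G →
      ∫⁻ y, ENNReal.ofReal (weightedPower q α u y) = ENNReal.ofReal G →
      ENNReal.ofReal (C⁻¹ * G ^ θ) ≤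
        ∫⁻ x, ∫⁻ y, ENNReal.ofReal (gagliardoKernel p d β u x y) := by
  have : Nonempty (Fin N) := ⟨⟨0, hN⟩⟩
  have : Nontrivial (Euc N) := inferInstance
  have hc := unitBallVolume_pos N
  obtain ⟨M, hM1, hM⟩ : ∃ M : ℝ, 1 ≤ M ∧
      2 * 2 ^ q * 3 ^ |α| * 3 ^ (N : ℝ) * M ^ (α - N) ≤ 1 / 2 := by
    have h := (tendsto_rpow_neg_atTop (sub_pos.2 hα)).const_mul
      (2 * 2 ^ q * 3 ^ |α| * 3 ^ (N : ℝ))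
    rw [mul_zero, neg_sub] at h
    obtain ⟨M, h1, h2⟩ :=
      ((h.eventually_le_const (by norm_num : (0 : ℝ) < 1 / 2)).and (eventually_ge_atTop 1)).exists
    exact ⟨M, h2, h1⟩
  have hM0 : 0 < M := by linarith
  obtain ⟨C, hC, hpt⟩ := exists_weightedPower_le hN hp hq hθ hθ1 hqθ hαθ hd hM1
  refine ⟨2 * C, by positivity, fun u hu G hG hGW => ?_⟩
  set κ : ℝ := 2 * 2 ^ q * 3 ^ |α| / unitBallVolume N * M ^ (α - N) with hκ
  have hκ0 : 0 < κ := by positivity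
  have hκc : κ * (3 ^ (N : ℝ) * unitBallVolume N) ≤ 1 / 2 := by
    refine le_trans (le_of_eq ?_) hM
    rw [hκ]
    field_simp
  have hWm := (measurable_weightedPower (q := q) (α := α) hu).ennreal_ofReal
  set E : Euc N → ℝ≥0∞ := fun x => ∫⁻ y, ENNReal.ofReal (gagliardoKernel p d β u x y)
  have hEm : Measurable E := by
    refine Measurable.lintegral_prod_right ?_
    have := hu.measurable
    unfold Function.uncurry gagliardoKernel
    fun_prop
  set A : Euc N → ℝ≥0∞ := fun x =>
    ∫⁻ y in ball ((2 * M) • x) (M * ‖x‖), ENNReal.ofReal (weightedPower q α u y)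
  have hAtop : ∀ x, A x ≠ ⊤ := fun x =>
    ((setLIntegral_le_lintegral _ _).trans_lt (hGW ▸ ENNReal.ofReal_lt_top)).ne
  have hGpow : 0 < C * G ^ (1 - θ) := by positivity
  have hbound : ∀ x : Euc N, x ≠ 0 → ENNReal.ofReal (weightedPower q α u x) ≤
      ENNReal.ofReal (C * G ^ (1 - θ)) * E x +
        ENNReal.ofReal κ * (ENNReal.ofReal ((‖x‖ ^ (N : ℝ))⁻¹) * A x) := by
    intro x hx
    by_cases hEx : E x = ⊤
    · rw [hEx, ENNReal.mul_top (ENNReal.ofReal_pos.2 hGpow).ne', top_add]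
      exact le_top
    · have h := hpt u hu x hx G (E x).toReal (A x).toReal hG ENNReal.toReal_nonneg
        ENNReal.toReal_nonneg hGW.le (ENNReal.ofReal_toReal hEx).ge
        (ENNReal.ofReal_toReal (hAtop x)).ge
      refine (ENNReal.ofReal_le_ofReal h).trans_eq ?_
      rw [ENNReal.ofReal_add (by positivity) (by positivity), ENNReal.ofReal_mul hGpow.le,
        ENNReal.ofReal_mul (by positivity : 0 ≤ κ * (‖x‖ ^ (N : ℝ))⁻¹), ENNReal.ofReal_mul hκ0.le,
        ENNReal.ofReal_toReal hEx, ENNReal.ofReal_toReal (hAtop x), mul_assoc (ENNReal.ofReal κ)]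
  have hsum : ENNReal.ofReal G ≤ ENNReal.ofReal (C * G ^ (1 - θ)) * (∫⁻ x, E x) +
      ENNReal.ofReal (G / 2) := by
    calc ENNReal.ofReal G = ∫⁻ x, ENNReal.ofReal (weightedPower q α u x) := hGW.symm
      _ ≤ ∫⁻ x, (ENNReal.ofReal (C * G ^ (1 - θ)) * E x +
            ENNReal.ofReal κ * (ENNReal.ofReal ((‖x‖ ^ (N : ℝ))⁻¹) * A x)) := by
          refine lintegral_mono_ae ?_
          filter_upwards [Measure.ae_ne volume (0 : Euc N)] with x hx
          exact hbound x hx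
      _ = ENNReal.ofReal (C * G ^ (1 - θ)) * (∫⁻ x, E x) +
            ENNReal.ofReal κ * ∫⁻ x, ENNReal.ofReal ((‖x‖ ^ (N : ℝ))⁻¹) * A x := by
          rw [lintegral_add_left (hEm.const_mul _),
            lintegral_const_mul' _ _ ENNReal.ofReal_ne_top,
            lintegral_const_mul' _ _ ENNReal.ofReal_ne_top]
      _ ≤ ENNReal.ofReal (C * G ^ (1 - θ)) * (∫⁻ x, E x) +
            ENNReal.ofReal κ *
              (ENNReal.ofReal (3 ^ (N : ℝ) * unitBallVolume N) * ENNReal.ofReal G) := by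
          gcongr
          rw [← hGW]
          exact lintegral_ball_average_le hN hM0 hWm
      _ ≤ _ := by
          gcongr
          rw [← mul_assoc, ← ENNReal.ofReal_mul hκ0.le, ← ENNReal.ofReal_mul (by positivity)]
          apply ENNReal.ofReal_le_ofReal
          nlinarith
  by_cases htop : ∫⁻ x, E x = ⊤
  · rw [htop]
    exact le_top
  rw [← ENNReal.ofReal_toReal htop] at hsum ⊢
  have hT : 0 ≤ (∫⁻ x, E x).toReal := ENNReal.toReal_nonneg
  rw [← ENNReal.ofReal_mul hGpow.le, ← ENNReal.ofReal_add (by positivity) (by positivity),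
    ENNReal.ofReal_le_ofReal_iff (by positivity)] at hsum
  apply ENNReal.ofReal_le_ofReal
  have hGs : G = G ^ θ * G ^ (1 - θ) := by rw [← rpow_add hG]; simp
  have hG1 : 0 < G ^ (1 - θ) := by positivity
  rw [inv_mul_le_iff₀ (by positivity), ← mul_le_mul_iff_of_pos_right hG1, ← hGs]
  linarith

/-- **Weighted fractional Sobolev inequality.** For `-ps < β < (N-ps)/2` there is
`S(N,s,β) > 0` such that for all `v ∈ C_c^∞(ℝ^N)`,
`∬ |v(x)-v(y)|^p/(|x-y|^{N+ps}|x|^β|y|^β) ≥ S (∫ |v|^{p*_s}/|x|^{2β p*_s/p})^{p/p*_s}`,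
where `p*_s = pN/(N-ps)`. -/
theorem weighted_fractional_sobolev (N : ℕ) (hN : 2 ≤ N) (s p β : ℝ)
    (hs0 : 0 < s) (hs1 : s < 1) (hp1 : 1 < p) (hps : p * s < N)
    (hβ1 : -(p * s) < β) (hβ2 : β < ((N : ℝ) - p * s) / 2) :
    ∃ S : ℝ, 0 < S ∧ ∀ v : Euc N → ℝ, ContDiff ℝ (⊤ : ℕ∞) v → HasCompactSupport v →
      ENNReal.ofReal (S * (∫ x, |v x| ^ (p * N / ((N : ℝ) - p * s)) /
            ‖x‖ ^ (2 * β * (p * N / ((N : ℝ) - p * s)) / p)) ^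
          (p / (p * N / ((N : ℝ) - p * s)))) ≤
        weightedGagliardoEnergy N p s β v := by
  have hn : (0 : ℝ) < N := by exact_mod_cast (by omega : 0 < N)
  have hps0 : 0 < p * s := by positivity
  have hp0 : 0 < p := by linarith
  have hm : 0 < (N : ℝ) - p * s := by linarith
  have hq0 : 0 < p * N / ((N : ℝ) - p * s) := by positivity
  have hθ : p / (p * N / ((N : ℝ) - p * s)) = ((N : ℝ) - p * s) / N := by field_simp
  rw [hθ]
  set q := p * N / ((N : ℝ) - p * s) with hq
  have hqp : q / p = N / ((N : ℝ) - p * s) := by rw [hq]; field_simp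
  obtain ⟨C, hC, h⟩ := exists_rpow_lintegral_weightedPower_le (N := N) (p := p)
    (d := N + p * s) (β := β) (q := q) (α := 2 * β * q / p) (θ := ((N : ℝ) - p * s) / N)
    (by omega) hp0 hq0 (by positivity) (by rw [div_le_one hn]; linarith)
    (by rw [hq]; field_simp) (by rw [hq]; field_simp) (by field_simp; ring)
    (by
      rw [mul_div_assoc, hqp, mul_div_assoc', div_lt_iff₀ hm]
      nlinarith)
  refine ⟨C⁻¹, by positivity, fun v hv _ => ?_⟩
  change ENNReal.ofReal (C⁻¹ * (∫ x, weightedPower q (2 * β * q / p) v x) ^ _) ≤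
    ∫⁻ x, ∫⁻ y, ENNReal.ofReal (gagliardoKernel p (N + p * s) β v x y)
  have hI0 : 0 ≤ ∫ x, weightedPower q (2 * β * q / p) v x :=
    integral_nonneg fun x => weightedPower_nonneg x
  rcases hI0.eq_or_lt with h0 | hpos
  · rw [← h0, zero_rpow (by positivity)]
    simp
  · have hi : Integrable (weightedPower q (2 * β * q / p) v) := by
      by_contra hni
      exact hpos.ne' (integral_undef hni)
    exact h v hv.continuous _ hpos
      (ofReal_integral_eq_lintegral_ofReal hi (ae_of_all _ weightedPower_nonneg)).symm
end
end

section
/- (Weighted fractional Hardy inequality) Let N ≥ 2 be an integer, 0 < s < 1 and p > 1 with ps < N, and let β satisfy −ps < β < (N−ps)/2. There exists a positive constant C = C(N,p,s,β) such that for all u ∈ C_c^∞(ℝ^N): C · ∫_{ℝ^N} |u(x)|^p / |x|^{ps+2β} dx ≤ ∬_{ℝ^N×ℝ^N} |u(x)−u(y)|^p / ( |x−y|^{N+ps} |x|^β |y|^β ) dx dy. -/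
open MeasureTheory Real Set Filter Metric
open scoped ENNReal Topology NNReal

noncomputable section

lemma volume_annulus (N : ℕ) (hN : 1 ≤ N) {r R : ℝ} (hr : 0 ≤ r) (hrR : r ≤ R) :
    volume {y : Euc N | r < ‖y‖ ∧ ‖y‖ < R} =
      ENNReal.ofReal (R ^ N - r ^ N) * volume (ball (0 : Euc N) 1) := by
  have : Nontrivial (Euc N) := by
    apply Module.nontrivial_of_finrank_pos (R := ℝ)
    simpa using Nat.pos_of_ne_zero (Nat.one_le_iff_ne_zero.1 hN)
  have hset : {y : Euc N | r < ‖y‖ ∧ ‖y‖ < R} = ball 0 R \ closedBall 0 r := by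
    ext y
    simp [and_comm]
  rcases hrR.eq_or_lt with rfl | hlt
  · simp [hset, sdiff_eq_empty.2 ball_subset_closedBall]
  rw [hset, measure_sdiff (closedBall_subset_ball hlt) measurableSet_closedBall.nullMeasurableSet
      measure_closedBall_lt_top.ne, Measure.addHaar_ball _ _ (hr.trans hrR),
    Measure.addHaar_closedBall _ _ hr, finrank_euclideanSpace_fin,
    ENNReal.ofReal_sub _ (by positivity), ENNReal.sub_mul (fun _ _ ↦ measure_ball_lt_top.ne)]

lemma measurableSet_lt_and_lt {α : Type*} [MeasurableSpace α] {f g h k : α → ℝ}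
    (hf : Measurable f) (hg : Measurable g) (hh : Measurable h) (hk : Measurable k) :
    MeasurableSet {x | f x < g x ∧ h x < k x} := by
  rw [ofPred_and]
  exact (measurableSet_lt hf hg).inter (measurableSet_lt hh hk)

/-- The pairs `(x, y)` with `L * ‖x‖ < ‖y‖ < 2 * ‖x‖`. -/
def conicRegion (N : ℕ) (L : ℝ) : Set (Euc N × Euc N) :=
  {z | L * ‖z.1‖ < ‖z.2‖ ∧ ‖z.2‖ < 2 * ‖z.1‖}

lemma measurableSet_conicRegion (N : ℕ) (L : ℝ) : MeasurableSet (conicRegion N L) :=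
  measurableSet_lt_and_lt (by fun_prop) (by fun_prop) (by fun_prop) (by fun_prop)

/-- The weight `‖x‖ ^ (-(N + a))` restricted to the conic region. -/
def conicWeight (N : ℕ) (L a : ℝ) : Euc N × Euc N → ℝ≥0∞ :=
  (conicRegion N L).indicator fun z ↦ ENNReal.ofReal (‖z.1‖ ^ (-((N : ℝ) + a)))

lemma measurable_conicWeight (N : ℕ) (L a : ℝ) : Measurable (conicWeight N L a) := by
  refine Measurable.indicator ?_ (measurableSet_conicRegion N L)
  fun_prop

lemma ae_ne_zero (N : ℕ) (hN : 1 ≤ N) : ∀ᵐ x : Euc N, x ≠ 0 := by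
  have : Nontrivial (Euc N) := by
    apply Module.nontrivial_of_finrank_pos (R := ℝ)
    simpa using Nat.pos_of_ne_zero (Nat.one_le_iff_ne_zero.1 hN)
  simp [ae_iff]

lemma lintegral_conicWeight_mul_fst (N : ℕ) (hN : 1 ≤ N) {L a : ℝ} (hL1 : 1 < L) (hL2 : L < 2)
    {f : Euc N → ℝ≥0∞} (hf : Measurable f) :
    ∫⁻ z, conicWeight N L a z * f z.1 =
      ENNReal.ofReal (2 ^ N - L ^ N) * volume (ball (0 : Euc N) 1) *
        ∫⁻ x, f x * ENNReal.ofReal (‖x‖ ^ (-a)) := by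
  have hw := measurable_conicWeight N L a
  rw [Measure.volume_eq_prod, lintegral_prod _ (by fun_prop),
    ← lintegral_const_mul _ (by fun_prop)]
  refine lintegral_congr_ae ?_
  filter_upwards [ae_ne_zero N hN] with x hx
  have hx' : 0 < ‖x‖ := norm_pos_iff.2 hx
  have hind : ∀ y, conicWeight N L a (x, y) * f x =
      {y : Euc N | L * ‖x‖ < ‖y‖ ∧ ‖y‖ < 2 * ‖x‖}.indicator
        (fun _ ↦ ENNReal.ofReal (‖x‖ ^ (-((N : ℝ) + a))) * f x) y := by
    intro y
    by_cases h : L * ‖x‖ < ‖y‖ ∧ ‖y‖ < 2 * ‖x‖ <;>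
      simp [conicWeight, conicRegion, indicator, h]
  have hmeas : MeasurableSet {y : Euc N | L * ‖x‖ < ‖y‖ ∧ ‖y‖ < 2 * ‖x‖} :=
    measurableSet_lt_and_lt (by fun_prop) (by fun_prop) (by fun_prop) (by fun_prop)
  simp only [hind]
  rw [lintegral_indicator_const hmeas, volume_annulus N hN (by positivity) (by gcongr)]
  have hpow : ‖x‖ ^ (-((N : ℝ) + a)) * ((2 * ‖x‖) ^ N - (L * ‖x‖) ^ N) =
      (2 ^ N - L ^ N) * ‖x‖ ^ (-a) := by
    rw [neg_add, rpow_add hx', rpow_neg hx'.le, rpow_natCast, mul_pow, mul_pow]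
    field_simp
  have hnn : (0 : ℝ) ≤ 2 ^ N - L ^ N := sub_nonneg.2 (by gcongr)
  calc _ = ENNReal.ofReal (‖x‖ ^ (-((N : ℝ) + a)) * ((2 * ‖x‖) ^ N - (L * ‖x‖) ^ N)) *
        (f x * volume (ball (0 : Euc N) 1)) := by
        rw [ENNReal.ofReal_mul (by positivity)]; ring
    _ = _ := by rw [hpow, ENNReal.ofReal_mul hnn]; ring

lemma lintegral_conicWeight_mul_snd_le (N : ℕ) (hN : 1 ≤ N) {L a : ℝ} (hL1 : 1 < L) (hL2 : L < 2)
    (ha : 0 ≤ N + a) {f : Euc N → ℝ≥0∞} (hf : Measurable f) :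
    ∫⁻ z, conicWeight N L a z * f z.2 ≤
      ENNReal.ofReal (2 ^ a / L ^ N * (2 ^ N - L ^ N)) * volume (ball (0 : Euc N) 1) *
        ∫⁻ x, f x * ENNReal.ofReal (‖x‖ ^ (-a)) := by
  have hw := measurable_conicWeight N L a
  have hL0 : 0 < L := by linarith
  rw [Measure.volume_eq_prod, lintegral_prod_symm _ (by fun_prop),
    ← lintegral_const_mul _ (by fun_prop)]
  refine lintegral_mono_ae ?_
  filter_upwards [ae_ne_zero N hN] with y hy
  have hy' : 0 < ‖y‖ := norm_pos_iff.2 hy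
  have hind : ∀ x, conicWeight N L a (x, y) * f y ≤
      {x : Euc N | ‖y‖ / 2 < ‖x‖ ∧ ‖x‖ < ‖y‖ / L}.indicator
        (fun _ ↦ ENNReal.ofReal ((‖y‖ / 2) ^ (-((N : ℝ) + a))) * f y) x := by
    intro x
    by_cases h : L * ‖x‖ < ‖y‖ ∧ ‖y‖ < 2 * ‖x‖
    · have h1 : ‖y‖ / 2 < ‖x‖ := by linarith [h.2]
      have h2 : ‖x‖ < ‖y‖ / L := by rw [lt_div_iff₀ hL0]; linarith [h.1]
      simp only [conicWeight, conicRegion, indicator, mem_ofPred_eq, h, h1, h2, and_self, if_true]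
      gcongr ENNReal.ofReal ?_ * _
      exact rpow_le_rpow_of_nonpos (by positivity) h1.le (by linarith)
    · simp [conicWeight, conicRegion, indicator, h]
  have hmeas : MeasurableSet {x : Euc N | ‖y‖ / 2 < ‖x‖ ∧ ‖x‖ < ‖y‖ / L} :=
    measurableSet_lt_and_lt (by fun_prop) (by fun_prop) (by fun_prop) (by fun_prop)
  refine (lintegral_mono hind).trans_eq ?_
  rw [lintegral_indicator_const hmeas, volume_annulus N hN (by positivity) (by gcongr)]
  have hpow : (‖y‖ / 2) ^ (-((N : ℝ) + a)) * ((‖y‖ / L) ^ N - (‖y‖ / 2) ^ N) =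
      2 ^ a / L ^ N * (2 ^ N - L ^ N) * ‖y‖ ^ (-a) := by
    rw [neg_add, rpow_add (by positivity), rpow_neg (by positivity), rpow_natCast,
      div_rpow hy'.le (by norm_num), rpow_neg (by norm_num : (0 : ℝ) ≤ 2),
      div_pow, div_pow]
    field_simp
  have hnn : (0 : ℝ) ≤ 2 ^ N - L ^ N := sub_nonneg.2 (by gcongr)
  calc _ = ENNReal.ofReal ((‖y‖ / 2) ^ (-((N : ℝ) + a)) * ((‖y‖ / L) ^ N - (‖y‖ / 2) ^ N)) *
        (f y * volume (ball (0 : Euc N) 1)) := by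
        rw [ENNReal.ofReal_mul (by positivity)]; ring
    _ = _ := by rw [hpow, ENNReal.ofReal_mul (by positivity)]; ring

lemma rpow_le_two_rpow_abs_mul {r t b : ℝ} (hr : 0 < r) (h1 : r ≤ t) (h2 : t ≤ 2 * r) :
    t ^ b ≤ 2 ^ |b| * r ^ b := by
  have ht : 1 ≤ t / r := (one_le_div hr).2 h1
  have ht' : t / r ≤ 2 := (div_le_iff₀ hr).2 h2
  calc t ^ b = (t / r) ^ b * r ^ b := by
        rw [← mul_rpow (by positivity) hr.le, div_mul_cancel₀ _ hr.ne']
    _ ≤ 2 ^ |b| * r ^ b := by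
        gcongr
        exact (rpow_le_rpow_of_exponent_le ht (le_abs_self b)).trans
          (rpow_le_rpow (by positivity) ht' (abs_nonneg b))

lemma lintegral_conicWeight_mul_le_energy (N : ℕ) {p s β L : ℝ} (hps : 0 ≤ p * s) (hp : 0 ≤ p)
    (hL : 1 < L) {u : Euc N → ℝ} (hu : Measurable u) :
    ENNReal.ofReal ((3 ^ ((N : ℝ) + p * s) * 2 ^ |β|)⁻¹) *
      ∫⁻ z, conicWeight N L (p * s + 2 * β) z * ENNReal.ofReal |u z.1 - u z.2| ^ p ≤
      weightedGagliardoEnergy N p s β u := by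
  have hw := measurable_conicWeight N L (p * s + 2 * β)
  have hm : Measurable fun z : Euc N × Euc N ↦
      conicWeight N L (p * s + 2 * β) z * ENNReal.ofReal |u z.1 - u z.2| ^ p := by fun_prop
  rw [← lintegral_const_mul _ hm, Measure.volume_eq_prod, lintegral_prod _ (by fun_prop)]
  refine lintegral_mono fun x ↦ lintegral_mono fun y ↦ ?_
  by_cases h : L * ‖x‖ < ‖y‖ ∧ ‖y‖ < 2 * ‖x‖
  swap
  · simp [conicWeight, conicRegion, indicator, h]
  simp only [conicWeight, conicRegion, indicator, mem_ofPred_eq, h, and_self, if_true]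
  have hx : 0 < ‖x‖ := by linarith [norm_nonneg y, h.2]
  have hxy : ‖x‖ < ‖y‖ := by nlinarith [h.1]
  have hy : 0 < ‖y‖ := hx.trans hxy
  have hsub : 0 < ‖x - y‖ := by
    rw [norm_sub_rev]; linarith [norm_sub_norm_le y x]
  have hsub3 : ‖x - y‖ ≤ 3 * ‖x‖ := by linarith [norm_sub_le x y, h.2]
  rw [ENNReal.ofReal_rpow_of_nonneg (abs_nonneg _) hp, ← ENNReal.ofReal_mul (by positivity),
    ← ENNReal.ofReal_mul (by positivity)]
  refine ENNReal.ofReal_le_ofReal ?_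
  have hden : ‖x - y‖ ^ ((N : ℝ) + p * s) * ‖x‖ ^ β * ‖y‖ ^ β ≤
      3 ^ ((N : ℝ) + p * s) * 2 ^ |β| * ‖x‖ ^ ((N : ℝ) + (p * s + 2 * β)) := by
    calc _ ≤ (3 * ‖x‖) ^ ((N : ℝ) + p * s) * ‖x‖ ^ β * (2 ^ |β| * ‖x‖ ^ β) := by
          gcongr
          exact rpow_le_two_rpow_abs_mul hx hxy.le h.2.le
      _ = _ := by
          rw [mul_rpow (by norm_num) hx.le,
            show (N : ℝ) + (p * s + 2 * β) = ((N : ℝ) + p * s) + β + β by ring,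
            rpow_add hx _ β, rpow_add hx _ β]
          ring
  calc _ = |u x - u y| ^ p /
        (3 ^ ((N : ℝ) + p * s) * 2 ^ |β| * ‖x‖ ^ ((N : ℝ) + (p * s + 2 * β))) := by
        rw [rpow_neg hx.le]; field_simp
    _ ≤ _ := by gcongr

lemma lintegral_rpow_mul_norm_rpow_ne_top (N : ℕ) (hN : 1 ≤ N) {p a : ℝ} (hp : 0 < p)
    (ha : a < N) {u : Euc N → ℝ} (hu : Continuous u) (hc : HasCompactSupport u) :
    ∫⁻ x, ENNReal.ofReal |u x| ^ p * ENNReal.ofReal (‖x‖ ^ (-a)) ≠ ∞ := by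
  have hloc : LocallyIntegrable (fun x : Euc N ↦ ‖x‖ ^ (-a)) := by
    refine locallyIntegrable_of_norm_le_rpow (C := 1) (α := a) (by simpa using hN)
      (by simpa using ha) (ae_of_all _ fun x ↦ ?_) (measurable_norm.pow_const _).aestronglyMeasurable
    rw [norm_of_nonneg (by positivity), one_mul]
  have hcont : Continuous fun x ↦ |u x| ^ p := hu.abs.rpow_const fun _ ↦ Or.inr hp.le
  have hsupp : HasCompactSupport fun x ↦ |u x| ^ p :=
    hc.comp_left (g := fun t : ℝ ↦ |t| ^ p) (by simp [hp.ne'])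
  have hint := hloc.integrable_smul_left_of_hasCompactSupport hcont hsupp
  refine ne_of_eq_of_ne (lintegral_congr fun x ↦ ?_) hint.lintegral_lt_top.ne
  rw [ENNReal.ofReal_rpow_of_nonneg (abs_nonneg _) hp.le, ← ENNReal.ofReal_mul (by positivity),
    smul_eq_mul]

/-- If `A ≤ B + D` in `L^p` norm with `A = K * I`, `B ≤ k * I` and `k < K`, then `D` controls `I`. -/
lemma exists_pos_mul_le_of_rpow_le_add {p : ℝ} (hp : 0 < p) {k K : ℝ≥0∞} (hkK : k < K)
    (hK : K ≠ ∞) : ∃ c : ℝ, 0 < c ∧ ∀ I D : ℝ≥0∞, I ≠ ∞ →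
      (K * I) ^ (1 / p) ≤ (k * I) ^ (1 / p) + D ^ (1 / p) → ENNReal.ofReal c * I ≤ D := by
  have hq : 0 < 1 / p := by positivity
  have hlt : k ^ (1 / p) < K ^ (1 / p) := ENNReal.rpow_lt_rpow hkK hq
  have hKt : K ^ (1 / p) ≠ ∞ := ENNReal.rpow_ne_top_of_nonneg hq.le hK
  set δ := K ^ (1 / p) - k ^ (1 / p) with hδ
  have hδ0 : 0 < δ := tsub_pos_of_lt hlt
  have hδt : δ ≠ ∞ := ENNReal.sub_ne_top hKt
  refine ⟨(δ ^ p).toReal, ENNReal.toReal_pos (ENNReal.rpow_pos hδ0 hδt).ne'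
    (ENNReal.rpow_ne_top_of_nonneg hp.le hδt), fun I D hI h ↦ ?_⟩
  rw [ENNReal.ofReal_toReal (ENNReal.rpow_ne_top_of_nonneg hp.le hδt)]
  have hle : δ * I ^ (1 / p) ≤ D ^ (1 / p) := by
    rw [hδ, ENNReal.sub_mul (fun _ _ ↦ ENNReal.rpow_ne_top_of_nonneg hq.le hI),
      ← ENNReal.mul_rpow_of_nonneg _ _ hq.le, ← ENNReal.mul_rpow_of_nonneg _ _ hq.le]
    exact tsub_le_iff_left.2 h
  have := ENNReal.rpow_le_rpow hle hp.le
  rwa [ENNReal.mul_rpow_of_nonneg _ _ hp.le, ← ENNReal.rpow_mul, ← ENNReal.rpow_mul,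
    one_div_mul_cancel hp.ne', ENNReal.rpow_one, ENNReal.rpow_one] at this

lemma exists_two_rpow_lt_pow (N : ℕ) (hN : 1 ≤ N) {a : ℝ} (ha : a < N) :
    ∃ L : ℝ, 1 < L ∧ L < 2 ∧ (2 : ℝ) ^ a < L ^ N := by
  have hN' : (0 : ℝ) < N := by exact_mod_cast hN
  obtain ⟨θ, h1, h2⟩ := exists_between (max_lt zero_lt_one ((div_lt_one hN').2 ha))
  obtain ⟨h0, h3⟩ := max_lt_iff.1 h1
  refine ⟨2 ^ θ, one_lt_rpow (by norm_num) h0, ?_, ?_⟩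
  · simpa using rpow_lt_rpow_of_exponent_lt (by norm_num : (1 : ℝ) < 2) h2
  · rw [← rpow_natCast, ← rpow_mul (by norm_num)]
    exact rpow_lt_rpow_of_exponent_lt (by norm_num) ((div_lt_iff₀ hN').1 h3)

/-- **Weighted fractional Hardy inequality.** For `-ps < β < (N-ps)/2` there is
`C = C(N,p,s,β) > 0` such that for all `u ∈ C_c^∞(ℝ^N)`,
`C ∫ |u|^p/|x|^{ps+2β} ≤ ∬ |u(x)-u(y)|^p/(|x-y|^{N+ps}|x|^β|y|^β)`. -/
theorem weighted_fractional_hardy (N : ℕ) (hN : 2 ≤ N) (s p β : ℝ)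
    (hs0 : 0 < s) (hs1 : s < 1) (hp1 : 1 < p) (hps : p * s < N)
    (hβ1 : -(p * s) < β) (hβ2 : β < ((N : ℝ) - p * s) / 2) :
    ∃ C : ℝ, 0 < C ∧ ∀ u : Euc N → ℝ, ContDiff ℝ (⊤ : ℕ∞) u → HasCompactSupport u →
      ENNReal.ofReal C * (∫⁻ x, ENNReal.ofReal (|u x| ^ p / ‖x‖ ^ (p * s + 2 * β))) ≤
        weightedGagliardoEnergy N p s β u := by
  have hN1 : 1 ≤ N := by omega
  have hps0 : 0 < p * s := by positivity
  have hp0 : 0 < p := by linarith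
  set a := p * s + 2 * β with ha
  obtain ⟨L, hL1, hL2, hLa⟩ := exists_two_rpow_lt_pow N hN1 (a := a) (by linarith)
  have hV0 : volume (ball (0 : Euc N) 1) ≠ 0 := (measure_ball_pos _ _ one_pos).ne'
  have hVt : volume (ball (0 : Euc N) 1) ≠ ∞ := measure_ball_lt_top.ne
  have hgap : 0 < (2 : ℝ) ^ N - L ^ N := sub_pos.2 (by gcongr)
  have hkK : ENNReal.ofReal (2 ^ a / L ^ N * (2 ^ N - L ^ N)) * volume (ball (0 : Euc N) 1) <
      ENNReal.ofReal (2 ^ N - L ^ N) * volume (ball (0 : Euc N) 1) := by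
    refine (ENNReal.mul_lt_mul_iff_left hV0 hVt).2 ((ENNReal.ofReal_lt_ofReal_iff hgap).2 ?_)
    exact mul_lt_of_lt_one_left hgap ((div_lt_one (by positivity)).2 hLa)
  obtain ⟨c, hc, hcI⟩ := exists_pos_mul_le_of_rpow_le_add hp0 hkK
    (ENNReal.mul_ne_top ENNReal.ofReal_ne_top hVt)
  refine ⟨(3 ^ ((N : ℝ) + p * s) * 2 ^ |β|)⁻¹ * c, by positivity, fun u hu hsupp ↦ ?_⟩
  have hum : Measurable u := hu.continuous.measurable
  refine le_trans ?_ (lintegral_conicWeight_mul_le_energy N hps0.le hp0.le hL1 hum)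
  rw [ENNReal.ofReal_mul (by positivity), mul_assoc]
  gcongr
  have hI : ∫⁻ x, ENNReal.ofReal (|u x| ^ p / ‖x‖ ^ a) =
      ∫⁻ x, ENNReal.ofReal |u x| ^ p * ENNReal.ofReal (‖x‖ ^ (-a)) := by
    refine lintegral_congr fun x ↦ ?_
    rw [ENNReal.ofReal_rpow_of_nonneg (abs_nonneg _) hp0.le, ← ENNReal.ofReal_mul (by positivity),
      rpow_neg (norm_nonneg _), div_eq_mul_inv]
  rw [hI]
  have hw := measurable_conicWeight N L a
  refine hcI _ _ (lintegral_rpow_mul_norm_rpow_ne_top N hN1 hp0 (by linarith) hu.continuous hsupp) ?_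
  have hfm : Measurable fun x ↦ ENNReal.ofReal |u x| ^ p := by fun_prop
  set μ : Measure (Euc N × Euc N) := volume.withDensity (conicWeight N L a) with hμ
  have hdens : ∀ g : Euc N × Euc N → ℝ≥0∞, Measurable g →
      ∫⁻ z, g z ∂μ = ∫⁻ z, conicWeight N L a z * g z := fun g hg ↦ by
    rw [hμ, lintegral_withDensity_eq_lintegral_mul _ hw hg]; rfl
  rw [← lintegral_conicWeight_mul_fst N hN1 hL1 hL2 hfm, ← hdens _ (by fun_prop),
    ← hdens _ (by fun_prop)]
  calc (∫⁻ z : Euc N × Euc N, ENNReal.ofReal |u z.1| ^ p ∂μ) ^ (1 / p)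
      ≤ (∫⁻ z, ((fun z : Euc N × Euc N ↦ ENNReal.ofReal |u z.2|) +
          fun z : Euc N × Euc N ↦ ENNReal.ofReal |u z.1 - u z.2|) z ^ p ∂μ) ^ (1 / p) := by
        gcongr with z
        rw [Pi.add_apply, ← ENNReal.ofReal_add (abs_nonneg _) (abs_nonneg _)]
        refine ENNReal.ofReal_le_ofReal ?_
        simpa using abs_add_le (u z.2) (u z.1 - u z.2)
    _ ≤ (∫⁻ z : Euc N × Euc N, ENNReal.ofReal |u z.2| ^ p ∂μ) ^ (1 / p) +
          (∫⁻ z : Euc N × Euc N, ENNReal.ofReal |u z.1 - u z.2| ^ p ∂μ) ^ (1 / p) :=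
        ENNReal.lintegral_Lp_add_le
          (by fun_prop : Measurable fun z : Euc N × Euc N ↦ ENNReal.ofReal |u z.2|).aemeasurable
          (by fun_prop : Measurable fun z : Euc N × Euc N ↦
            ENNReal.ofReal |u z.1 - u z.2|).aemeasurable hp1.le
    _ ≤ _ := by
        gcongr
        rw [hdens _ (by fun_prop)]
        exact lintegral_conicWeight_mul_snd_le N hN1 hL1 hL2 (by linarith) hfm
end
end

section
/- Let N ≥ 2 be an integer, 0 < s < 1 and 1 < p < 2 with ps < N, and set γ̄ = ps/(2−p). If p < 2N/(N+s) then γ̄ < (N−ps)/(p−1) and Ψ₁(γ̄) = −Θ(γ̄) ≥ −Λ_{N,p,s}; if p ≥ 2N/(N+s) then ps ≥ N − γ̄(p−1) and Ψ₁(γ̄) ≥ 0 (where Ψ₁(γ̄) is interpreted as an integral with value in (−∞, +∞]). Consequently, for every λ > Λ_{N,p,s} one has Ψ₁(γ̄) + λ > 0. -/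
open MeasureTheory Real Set Filter Metric
open scoped ENNReal Topology NNReal

noncomputable section

/-- The spherical kernel `K(σ)`. -/
def sphereKernel (N : ℕ) (p s : ℝ) (e : Euc N) (σ : ℝ) : ℝ :=
  ∫ y in Metric.sphere (0 : Euc N) 1, ‖e - σ • y‖ ^ (-((N : ℝ) + p * s)) ∂ μH[(N : ℝ) - 1]

/-- The optimal fractional Hardy constant `Λ_{N,p,s}`. -/
def hardyConst (N : ℕ) (p s : ℝ) (e : Euc N) : ℝ :=
  ∫ σ in Set.Ioo (0:ℝ) 1,
    σ ^ (p * s - 1) * (1 - σ ^ (((N : ℝ) - p * s) / p)) ^ p * sphereKernel N p s e σ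

/-- `Θ(η) = ∫_1^∞ K(σ)(σ^η-1)^{p-1}(σ^{N-1-η(p-1)} - σ^{ps-1}) dσ`. -/
def theta (N : ℕ) (p s η : ℝ) (e : Euc N) : ℝ :=
  ∫ σ in Set.Ioi (1:ℝ),
    sphereKernel N p s e σ * (σ ^ η - 1) ^ (p - 1) *
      (σ ^ ((N : ℝ) - 1 - η * (p - 1)) - σ ^ (p * s - 1))

/-- The integrand of `Ψ₁(γ̄)` written (via the reflection `σ ↦ 1/σ`, cf. identity (psi11) of
the paper) as an integral over `(1,∞)`:
`Ψ₁(γ̄) = ∫_1^∞ K(σ)(σ^γ̄-1)^{p-1}(σ^{ps-1} - σ^{N-1-γ̄(p-1)}) dσ`. -/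
def psiOneIntegrand (N : ℕ) (p s γ : ℝ) (e : Euc N) (σ : ℝ) : ℝ :=
  sphereKernel N p s e σ * (σ ^ γ - 1) ^ (p - 1) *
    (σ ^ (p * s - 1) - σ ^ ((N : ℝ) - 1 - γ * (p - 1)))

/-- `Ψ₁(γ̄)` interpreted as an extended-real number in `(-∞, +∞]`: the difference of the
lower integrals of the positive and negative parts of its integrand. -/
def psiOneE (N : ℕ) (p s γ : ℝ) (e : Euc N) : EReal :=
  ((∫⁻ σ in Set.Ioi (1:ℝ), ENNReal.ofReal (psiOneIntegrand N p s γ e σ) : ℝ≥0∞) : EReal) -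
    ((∫⁻ σ in Set.Ioi (1:ℝ), ENNReal.ofReal (-psiOneIntegrand N p s γ e σ) : ℝ≥0∞) : EReal)


lemma lipschitzWith_normalize_add {E : Type*} [NormedAddCommGroup E] [InnerProductSpace ℝ E]
    {e : E} (he : ‖e‖ = 1) :
    LipschitzWith 2 (fun w : (ℝ ∙ e)ᗮ => ‖e + (w : E)‖⁻¹ • (e + (w : E))) := by
  have one_le (w : (ℝ ∙ e)ᗮ) : 1 ≤ ‖e + (w : E)‖ := by
    have h0 : inner ℝ e (w : E) = 0 := Submodule.mem_orthogonal_singleton_iff_inner_right.1 w.2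
    have := norm_add_sq_eq_norm_sq_add_norm_sq_of_inner_eq_zero e (w : E) h0
    nlinarith [norm_nonneg (e + (w : E)), mul_self_nonneg ‖(w : E)‖]
  refine LipschitzWith.of_dist_le_mul fun w w' => ?_
  rw [dist_eq_norm, dist_eq_norm]
  have hsub : ‖w - w'‖ = ‖(e + (w : E)) - (e + (w' : E))‖ := by
    rw [← Submodule.norm_coe]; congr 1; simp
  rw [hsub]
  set x := e + (w : E)
  set y := e + (w' : E)
  have hx : 1 ≤ ‖x‖ := one_le w
  have hy : 1 ≤ ‖y‖ := one_le w'
  have hx0 : 0 < ‖x‖ := by linarith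
  have hy0 : 0 < ‖y‖ := by linarith
  have key : ‖x‖⁻¹ • x - ‖y‖⁻¹ • y = ‖x‖⁻¹ • (x - y) + (‖x‖⁻¹ * (‖y‖ - ‖x‖) * ‖y‖⁻¹) • y := by
    have : ‖x‖⁻¹ * (‖y‖ - ‖x‖) * ‖y‖⁻¹ = ‖x‖⁻¹ - ‖y‖⁻¹ := by field_simp
    rw [this]; module
  have hinv : ‖x‖⁻¹ ≤ 1 := inv_le_one_of_one_le₀ hx
  rw [key]
  calc _ ≤ ‖‖x‖⁻¹ • (x - y)‖ + ‖(‖x‖⁻¹ * (‖y‖ - ‖x‖) * ‖y‖⁻¹) • y‖ := norm_add_le _ _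
    _ = ‖x‖⁻¹ * ‖x - y‖ + ‖x‖⁻¹ * |‖y‖ - ‖x‖| := by
        simp only [norm_smul, norm_mul, norm_inv, Real.norm_eq_abs, abs_of_pos hx0, abs_of_pos hy0]
        field_simp
    _ ≤ 1 * ‖x - y‖ + 1 * ‖x - y‖ := by
        have : |‖y‖ - ‖x‖| ≤ ‖x - y‖ := by
          rw [abs_sub_comm]; exact abs_norm_sub_norm_le x y
        gcongr
    _ = _ := by push_cast; ring

lemma hausdorffMeasure_sphere_inter_closedBall_le_of_le_one {N : ℕ} (hN : 2 ≤ N) {e : Euc N}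
    (he : ‖e‖ = 1) :
    ∃ C : ℝ, 0 ≤ C ∧ ∀ r : ℝ, 0 < r → r ≤ 1 →
      μH[(N : ℝ) - 1] (sphere (0 : Euc N) 1 ∩ closedBall e r) ≤
        ENNReal.ofReal (C * r ^ ((N : ℝ) - 1)) := by
  obtain ⟨n, rfl⟩ : ∃ n, N = n + 1 := ⟨N - 1, by omega⟩
  have : Fact (Module.finrank ℝ (Euc (n + 1)) = n + 1) := ⟨by simp⟩
  have he0 : e ≠ 0 := by rintro rfl; simp at he
  have hfin : Module.finrank ℝ (ℝ ∙ e)ᗮ = n := Submodule.finrank_orthogonal_span_singleton he0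
  have hd : ((n + 1 : ℕ) : ℝ) - 1 = (Module.finrank ℝ (ℝ ∙ e)ᗮ : ℝ) := by rw [hfin]; simp
  have hHaar : (μH[(Module.finrank ℝ (ℝ ∙ e)ᗮ : ℝ)] : Measure (ℝ ∙ e)ᗮ).IsAddHaarMeasure :=
    inferInstance
  set m : ℝ≥0∞ := μH[(Module.finrank ℝ (ℝ ∙ e)ᗮ : ℝ)] (ball (0 : (ℝ ∙ e)ᗮ) 1) with hm
  have hmtop : m ≠ ⊤ := measure_ball_lt_top.ne
  refine ⟨2 ^ n * (2 ^ n * m.toReal), by positivity, fun r hr0 hr1 => ?_⟩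
  have hsub : sphere (0 : Euc (n + 1)) 1 ∩ closedBall e r ⊆
      (fun w : (ℝ ∙ e)ᗮ => ‖e + (w : Euc (n + 1))‖⁻¹ • (e + (w : Euc (n + 1)))) ''
        closedBall 0 (2 * r) := by
    rintro y ⟨hy1, hy2⟩
    have hy1 : ‖y‖ = 1 := by simpa using hy1
    have hy2 : ‖y - e‖ ≤ r := by simpa [dist_eq_norm] using hy2
    set t : ℝ := inner ℝ e y with ht
    have hsq : ‖y - e‖ ^ 2 = 2 - 2 * t := by
      rw [norm_sub_sq_real, hy1, he, real_inner_comm]; ring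
    have htt : 1 / 2 ≤ t := by nlinarith [norm_nonneg (y - e)]
    have ht0 : 0 < t := by linarith
    have hmem : t⁻¹ • y - e ∈ (ℝ ∙ e)ᗮ := by
      rw [Submodule.mem_orthogonal_singleton_iff_inner_right, inner_sub_right, inner_smul_right,
        ← ht, real_inner_self_eq_norm_sq, he]
      field_simp; simp
    refine ⟨⟨_, hmem⟩, ?_, ?_⟩
    · rw [mem_closedBall_zero_iff, ← Submodule.norm_coe]
      have h1 : ‖t⁻¹ • y - e‖ ^ 2 = t⁻¹ ^ 2 - 1 := by
        rw [norm_sub_sq_real, norm_smul, hy1, he, inner_smul_left, real_inner_comm, ← ht]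
        simp only [norm_inv, Real.norm_eq_abs, abs_of_pos ht0, map_inv₀, conj_trivial]
        field_simp; ring
      have h2 : t⁻¹ ^ 2 - 1 ≤ 4 * (2 - 2 * t) := by
        have : t⁻¹ ^ 2 - 1 = (1 - t ^ 2) / t ^ 2 := by field_simp
        rw [this, div_le_iff₀ (by positivity)]
        have ht1 : t ≤ 1 := by nlinarith [sq_nonneg ‖y - e‖]
        nlinarith [mul_nonneg (sub_nonneg.2 ht1) (sub_nonneg.2 htt),
          mul_nonneg (mul_nonneg (sub_nonneg.2 ht1) (sub_nonneg.2 htt)) ht0.le]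
      refine le_of_sq_le_sq ?_ (by positivity)
      nlinarith [norm_nonneg (y - e)]
    · simp only [add_sub_cancel, norm_smul, hy1, norm_inv, Real.norm_eq_abs, abs_of_pos ht0,
        mul_one, inv_inv, smul_smul]
      rw [mul_inv_cancel₀ ht0.ne', one_smul]
  calc _ ≤ _ := measure_mono hsub
    _ ≤ _ := (lipschitzWith_normalize_add he).hausdorffMeasure_image_le
        (by push_cast; linarith [n.cast_nonneg (α := ℝ)]) _
    _ = ENNReal.ofReal (2 ^ n * (2 ^ n * m.toReal) * r ^ (((n + 1 : ℕ) : ℝ) - 1)) := by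
        rw [hd, Measure.addHaar_closedBall _ _ (by positivity), ← hm, hfin, ENNReal.rpow_natCast,
          Real.rpow_natCast, mul_pow]
        rw [← ENNReal.ofReal_toReal hmtop, ENNReal.toReal_ofReal ENNReal.toReal_nonneg,
          ← ENNReal.ofReal_mul (by positivity)]
        rw [show ((2 : ℝ≥0) : ℝ≥0∞) = ENNReal.ofReal 2 by simp,
          ← ENNReal.ofReal_pow (by norm_num), ← ENNReal.ofReal_mul (by positivity)]
        ring_nf

lemma hausdorffMeasure_sphere_lt_top {N : ℕ} (hN : 2 ≤ N) :
    μH[(N : ℝ) - 1] (sphere (0 : Euc N) 1) < ⊤ := by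
  refine (isCompact_sphere _ _).measure_lt_top_of_nhdsWithin fun x hx => ?_
  obtain ⟨C, -, hC⟩ := hausdorffMeasure_sphere_inter_closedBall_le_of_le_one hN
    (e := x) (by simpa using hx)
  exact ⟨sphere 0 1 ∩ closedBall x 1,
    inter_mem_nhdsWithin _ (closedBall_mem_nhds _ one_pos),
    (hC 1 one_pos le_rfl).trans_lt ENNReal.ofReal_lt_top⟩

lemma hausdorffMeasure_sphere_inter_closedBall_le {N : ℕ} (hN : 2 ≤ N) {e : Euc N}
    (he : ‖e‖ = 1) :
    ∃ C : ℝ, 0 ≤ C ∧ ∀ r : ℝ, 0 < r →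
      μH[(N : ℝ) - 1] (sphere (0 : Euc N) 1 ∩ closedBall e r) ≤
        ENNReal.ofReal (C * r ^ ((N : ℝ) - 1)) := by
  obtain ⟨C, hC0, hC⟩ := hausdorffMeasure_sphere_inter_closedBall_le_of_le_one hN he
  have hS := (hausdorffMeasure_sphere_lt_top hN).ne
  set M := μH[(N : ℝ) - 1] (sphere (0 : Euc N) 1)
  have hN' : (2 : ℝ) ≤ N := by exact_mod_cast hN
  refine ⟨C + M.toReal, by positivity, fun r hr => ?_⟩
  rcases le_total r 1 with h | h
  · refine (hC r hr h).trans (ENNReal.ofReal_le_ofReal ?_)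
    gcongr
    simp
  · refine (measure_mono inter_subset_left).trans ?_
    refine (ENNReal.ofReal_toReal hS).symm.le.trans (ENNReal.ofReal_le_ofReal ?_)
    have h1 : 1 ≤ r ^ ((N : ℝ) - 1) := Real.one_le_rpow h (by linarith)
    have := ENNReal.toReal_nonneg (a := M)
    nlinarith

lemma norm_sub_smul_sq_of_norm_eq_one {E : Type*} [NormedAddCommGroup E] [InnerProductSpace ℝ E]
    {e y : E} (he : ‖e‖ = 1) (hy : ‖y‖ = 1) (σ : ℝ) :
    ‖e - σ • y‖ ^ 2 = (σ - 1) ^ 2 + σ * ‖y - e‖ ^ 2 := by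
  rw [norm_sub_sq_real, norm_sub_sq_real, inner_smul_right, norm_smul, he, hy, real_inner_comm,
    mul_one, Real.norm_eq_abs, sq_abs]
  ring

lemma sub_one_le_norm_sub_smul {E : Type*} [NormedAddCommGroup E] [InnerProductSpace ℝ E]
    {e y : E} (he : ‖e‖ = 1) (hy : ‖y‖ = 1) {σ : ℝ} (hσ : 1 < σ) : σ - 1 ≤ ‖e - σ • y‖ := by
  refine le_of_sq_le_sq ?_ (norm_nonneg _)
  rw [norm_sub_smul_sq_of_norm_eq_one he hy]
  nlinarith [mul_nonneg (zero_le_one.trans hσ.le) (sq_nonneg ‖y - e‖)]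

lemma norm_sub_le_norm_sub_smul {E : Type*} [NormedAddCommGroup E] [InnerProductSpace ℝ E]
    {e y : E} (he : ‖e‖ = 1) (hy : ‖y‖ = 1) {σ : ℝ} (hσ : 1 < σ) :
    ‖y - e‖ ≤ ‖e - σ • y‖ := by
  refine le_of_sq_le_sq ?_ (norm_nonneg _)
  rw [norm_sub_smul_sq_of_norm_eq_one he hy]
  nlinarith [mul_nonneg (sub_nonneg.2 hσ.le) (sq_nonneg ‖y - e‖), sq_nonneg (σ - 1)]

lemma sphereKernel_nonneg (N : ℕ) (p s : ℝ) (e : Euc N) (σ : ℝ) : 0 ≤ sphereKernel N p s e σ :=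
  integral_nonneg fun _ => by positivity

lemma sphereKernel_le_of_lintegral_le {N : ℕ} {p s : ℝ} {e : Euc N} {σ B : ℝ} (hB : 0 ≤ B)
    (h : ∫⁻ y in sphere (0 : Euc N) 1,
      ENNReal.ofReal (‖e - σ • y‖ ^ (-((N : ℝ) + p * s))) ∂ μH[(N : ℝ) - 1] ≤ ENNReal.ofReal B) :
    sphereKernel N p s e σ ≤ B := by
  rw [sphereKernel, integral_eq_lintegral_of_nonneg_ae
    (Eventually.of_forall fun _ => by positivity)
    (by apply Measurable.aestronglyMeasurable; fun_prop)]
  exact ENNReal.toReal_le_of_le_ofReal hB h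

lemma sphereKernel_inv {N : ℕ} {p s : ℝ} {e : Euc N} (he : ‖e‖ = 1) {σ : ℝ} (hσ : 0 < σ) :
    sphereKernel N p s e σ⁻¹ = σ ^ ((N : ℝ) + p * s) * sphereKernel N p s e σ := by
  rw [sphereKernel, sphereKernel, ← integral_const_mul]
  refine setIntegral_congr_fun isClosed_sphere.measurableSet fun y hy => ?_
  have hy : ‖y‖ = 1 := by simpa using hy
  have key : ‖e - σ⁻¹ • y‖ = σ⁻¹ * ‖e - σ • y‖ := by
    rw [← sq_eq_sq₀ (norm_nonneg _) (by positivity), mul_pow,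
      norm_sub_smul_sq_of_norm_eq_one he hy, norm_sub_smul_sq_of_norm_eq_one he hy]
    field_simp
    ring
  simp only [key]
  rw [Real.mul_rpow (by positivity) (norm_nonneg _), Real.inv_rpow hσ.le, ← Real.rpow_neg hσ.le,
    neg_neg]

lemma measurable_sphereKernel {N : ℕ} (hN : 2 ≤ N) (p s : ℝ) (e : Euc N) :
    Measurable (sphereKernel N p s e) := by
  have : IsFiniteMeasure ((μH[(N : ℝ) - 1] : Measure (Euc N)).restrict (sphere 0 1)) :=
    ⟨by simpa using hausdorffMeasure_sphere_lt_top hN⟩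
  have h : StronglyMeasurable
      (fun z : ℝ × Euc N => ‖e - z.1 • z.2‖ ^ (-((N : ℝ) + p * s))) := by
    apply Measurable.stronglyMeasurable
    fun_prop
  exact h.integral_prod_right'.measurable

lemma exists_sphereKernel_le_far {N : ℕ} (hN : 2 ≤ N) {p s : ℝ} (hps : 0 < p * s) {e : Euc N}
    (he : ‖e‖ = 1) :
    ∃ C : ℝ, 0 ≤ C ∧ ∀ σ : ℝ, 1 < σ →
      sphereKernel N p s e σ ≤ C * (σ - 1) ^ (-((N : ℝ) + p * s)) := by
  have hS := (hausdorffMeasure_sphere_lt_top hN).ne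
  refine ⟨(μH[(N : ℝ) - 1] (sphere (0 : Euc N) 1)).toReal, ENNReal.toReal_nonneg, fun σ hσ => ?_⟩
  have hσ' : 0 < σ - 1 := by linarith
  refine sphereKernel_le_of_lintegral_le (by positivity) ?_
  calc _ ≤ ∫⁻ _ in sphere (0 : Euc N) 1,
        ENNReal.ofReal ((σ - 1) ^ (-((N : ℝ) + p * s))) ∂ μH[(N : ℝ) - 1] := by
        refine setLIntegral_mono measurable_const fun y hy => ENNReal.ofReal_le_ofReal ?_
        have hy : ‖y‖ = 1 := by simpa using hy
        exact Real.rpow_le_rpow_of_nonpos hσ' (sub_one_le_norm_sub_smul he hy hσ)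
          (by linarith [N.cast_nonneg (α := ℝ)])
    _ = _ := by
        rw [setLIntegral_const, mul_comm, ENNReal.ofReal_mul ENNReal.toReal_nonneg,
          ENNReal.ofReal_toReal hS]

lemma exists_sphereKernel_le_near {N : ℕ} (hN : 2 ≤ N) {p s : ℝ} (hps : 0 < p * s) {e : Euc N}
    (he : ‖e‖ = 1) :
    ∃ C : ℝ, 0 ≤ C ∧ ∀ σ : ℝ, 1 < σ →
      sphereKernel N p s e σ ≤ C * (σ - 1) ^ (-(1 + p * s)) := by
  obtain ⟨C, hC0, hC⟩ := hausdorffMeasure_sphere_inter_closedBall_le hN he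
  have hN' : (2 : ℝ) ≤ N := by exact_mod_cast hN
  set α : ℝ := (N : ℝ) + p * s with hα
  have hα0 : 0 < α := by positivity
  set κ : ℝ := -(((N : ℝ) - 1) / α) with hκ
  have hκ1 : 0 < κ + 1 := by
    have : ((N : ℝ) - 1) / α < 1 := by rw [div_lt_one hα0]; linarith
    linarith
  refine ⟨C / (κ + 1), by positivity, fun σ hσ => ?_⟩
  have hδ : 0 < σ - 1 := by linarith
  refine sphereKernel_le_of_lintegral_le (by positivity) ?_
  set A : ℝ := (σ - 1) ^ (-α) with hA
  have hA0 : 0 < A := by positivity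
  have hlevel : ∀ t ∈ Ioi (0 : ℝ),
      ((μH[(N : ℝ) - 1] : Measure (Euc N)).restrict (sphere 0 1))
        {y | t ≤ ‖e - σ • y‖ ^ (-α)} ≤
      (Ioc 0 A).indicator (fun t => ENNReal.ofReal (C * t ^ κ)) t := by
    intro t ht
    have ht : 0 < t := ht
    have hmeas : MeasurableSet {y : Euc N | t ≤ ‖e - σ • y‖ ^ (-α)} :=
      measurableSet_le measurable_const (by fun_prop)
    rw [Measure.restrict_apply hmeas]
    by_cases htA : t ≤ A
    · rw [indicator_of_mem (show t ∈ Ioc 0 A from ⟨ht, htA⟩)]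
      have hpow : t ^ κ = (t ^ (-α⁻¹)) ^ ((N : ℝ) - 1) := by
        rw [← Real.rpow_mul ht.le, hκ]; congr 1; ring
      rw [hpow]
      refine (measure_mono ?_).trans (hC _ (by positivity))
      rintro y ⟨hy1, hy2⟩
      refine ⟨hy2, ?_⟩
      have hy2 : ‖y‖ = 1 := by simpa using hy2
      rw [mem_closedBall, dist_eq_norm]
      refine (norm_sub_le_norm_sub_smul he hy2 hσ).trans ?_
      have hD : 0 < ‖e - σ • y‖ := hδ.trans_le (sub_one_le_norm_sub_smul he hy2 hσ)
      have := Real.rpow_le_rpow_of_nonpos (z := -α⁻¹) ht hy1 (by simpa using hα0.le)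
      rwa [← Real.rpow_mul hD.le, neg_mul_neg, mul_inv_cancel₀ hα0.ne', Real.rpow_one] at this
    · refine le_of_eq_of_le (b := 0) ?_ zero_le
      rw [show {y : Euc N | t ≤ ‖e - σ • y‖ ^ (-α)} ∩ sphere 0 1 = ∅ from ?_, measure_empty]
      refine eq_empty_of_forall_notMem fun y hy => htA ?_
      have hy2 : ‖y‖ = 1 := by simpa using hy.2
      exact le_trans hy.1 (Real.rpow_le_rpow_of_nonpos hδ (sub_one_le_norm_sub_smul he hy2 hσ)
        (by linarith))
  rw [lintegral_eq_lintegral_meas_le _ (Eventually.of_forall fun _ => by positivity)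
    (by apply Measurable.aemeasurable; fun_prop)]
  have hint : IntegrableOn (fun t : ℝ => C * t ^ κ) (Ioc 0 A) :=
    (((intervalIntegral.intervalIntegrable_rpow' (by linarith)).const_mul C :
      IntervalIntegrable (fun t : ℝ => C * t ^ κ) volume 0 A).1)
  calc _ ≤ ∫⁻ t in Ioi (0 : ℝ), (Ioc 0 A).indicator (fun t => ENNReal.ofReal (C * t ^ κ)) t :=
        setLIntegral_mono' measurableSet_Ioi hlevel
    _ ≤ ∫⁻ t in Ioc (0 : ℝ) A, ENNReal.ofReal (C * t ^ κ) := by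
        rw [← lintegral_indicator measurableSet_Ioc]
        exact setLIntegral_le_lintegral _ _
    _ = ENNReal.ofReal (∫ t in Ioc (0 : ℝ) A, C * t ^ κ) := by
        refine (ofReal_integral_eq_lintegral_ofReal hint ?_).symm
        filter_upwards [ae_restrict_mem measurableSet_Ioc] with t ht
        have := ht.1
        simp only [Pi.zero_apply]
        positivity
    _ = _ := by
        congr 1
        rw [← intervalIntegral.integral_of_le hA0.le, intervalIntegral.integral_const_mul,
          integral_rpow (Or.inl (by linarith)), Real.zero_rpow hκ1.ne', hA, ← Real.rpow_mul hδ.le,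
          show -α * (κ + 1) = -(1 + p * s) by rw [hκ]; field_simp; rw [hα]; ring]
        ring

lemma rpow_sub_one_mul_add_one_le {θ a b : ℝ} (hθ0 : 0 ≤ θ) (hθ1 : θ ≤ 1) (ha : 1 ≤ a)
    (hb : 1 ≤ b) :
    (a - 1) ^ θ * (b - 1) ^ (1 - θ) + 1 ≤ a ^ θ * b ^ (1 - θ) := by
  have ha0 : 0 < a := by linarith
  have hb0 : 0 < b := by linarith
  have h1 := Real.geom_mean_le_arith_mean2_weighted hθ0 (sub_nonneg.2 hθ1)
    (div_nonneg (sub_nonneg.2 ha) ha0.le) (div_nonneg (sub_nonneg.2 hb) hb0.le) (by ring)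
  have h2 := Real.geom_mean_le_arith_mean2_weighted hθ0 (sub_nonneg.2 hθ1)
    (inv_nonneg.2 ha0.le) (inv_nonneg.2 hb0.le) (by ring)
  rw [Real.div_rpow (by linarith) ha0.le, Real.div_rpow (by linarith) hb0.le] at h1
  rw [Real.inv_rpow ha0.le, Real.inv_rpow hb0.le] at h2
  have hX : 0 < a ^ θ := by positivity
  have hY : 0 < b ^ (1 - θ) := by positivity
  have h3 : θ * ((a - 1) / a) + (1 - θ) * ((b - 1) / b) + (θ * a⁻¹ + (1 - θ) * b⁻¹) = 1 := by
    field_simp; ring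
  have h4 : ((a - 1) ^ θ * (b - 1) ^ (1 - θ) + 1) / (a ^ θ * b ^ (1 - θ)) ≤ 1 := by
    refine le_of_eq_of_le ?_ ((add_le_add h1 h2).trans h3.le)
    field_simp
  rwa [div_le_one (by positivity)] at h4

lemma rpow_sub_one_mul_le {p a b : ℝ} (hp : 1 < p) (ha : 1 ≤ a) (hb : 1 ≤ b) :
    (a - 1) ^ (p - 1) * (b - 1) ≤ (a ^ ((p - 1) / p) * b ^ p⁻¹ - 1) ^ p := by
  have hp0 : 0 < p := by linarith
  have ha' : 0 ≤ a - 1 := by linarith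
  have hb' : 0 ≤ b - 1 := by linarith
  have h := rpow_sub_one_mul_add_one_le (θ := (p - 1) / p) (div_nonneg (by linarith) hp0.le)
    (by rw [div_le_one hp0]; linarith) ha hb
  rw [show 1 - (p - 1) / p = p⁻¹ by field_simp; ring] at h
  have hpow := Real.rpow_le_rpow (by positivity) (le_sub_iff_add_le.2 h) hp0.le
  rwa [Real.mul_rpow (by positivity) (by positivity), ← Real.rpow_mul ha', ← Real.rpow_mul hb',
    div_mul_cancel₀ _ hp0.ne', inv_mul_cancel₀ hp0.ne', Real.rpow_one] at hpow

/-- The integrand of the Hardy constant after the reflection `σ ↦ 1/σ`. -/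
def hardyIntegrand (N : ℕ) (p s : ℝ) (e : Euc N) (σ : ℝ) : ℝ :=
  sphereKernel N p s e σ * (σ ^ (p * s - 1) * (σ ^ (((N : ℝ) - p * s) / p) - 1) ^ p)

lemma hardyConst_eq_integral_Ioi {N : ℕ} {p s : ℝ} (hp : 0 < p) (hps : p * s < N) {e : Euc N}
    (he : ‖e‖ = 1) : hardyConst N p s e = ∫ σ in Ioi (1 : ℝ), hardyIntegrand N p s e σ := by
  set g : ℝ → ℝ := fun σ =>
    σ ^ (p * s - 1) * (1 - σ ^ (((N : ℝ) - p * s) / p)) ^ p * sphereKernel N p s e σ with hg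
  have hβ : 0 < ((N : ℝ) - p * s) / p := div_pos (by linarith) hp
  have h1 := integral_comp_rpow_Ioi ((Ioo (0 : ℝ) 1).indicator g) (p := -1) (by norm_num)
  rw [setIntegral_indicator measurableSet_Ioo,
    inter_eq_self_of_subset_right Ioo_subset_Ioi_self] at h1
  rw [hardyConst, ← h1, ← inter_eq_self_of_subset_right (Ioi_subset_Ioi (zero_le_one (α := ℝ))),
    ← setIntegral_indicator measurableSet_Ioi]
  refine setIntegral_congr_fun measurableSet_Ioi fun σ hσ => ?_
  have hσ : 0 < σ := hσ
  simp only [Real.rpow_neg_one]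
  by_cases h : 1 < σ
  · have hmem : σ⁻¹ ∈ Ioo (0 : ℝ) 1 := ⟨by positivity, inv_lt_one_of_one_lt₀ h⟩
    have hone : 1 ≤ σ ^ (((N : ℝ) - p * s) / p) := Real.one_le_rpow h.le hβ.le
    have hsub : 1 - (σ ^ (((N : ℝ) - p * s) / p))⁻¹ =
        (σ ^ (((N : ℝ) - p * s) / p) - 1) * σ ^ (-(((N : ℝ) - p * s) / p)) := by
      rw [Real.rpow_neg hσ.le, sub_mul, mul_inv_cancel₀ (by positivity), one_mul]
    rw [indicator_of_mem hmem, indicator_of_mem (show σ ∈ Ioi (1 : ℝ) from h), hg]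
    simp only [hardyIntegrand, sphereKernel_inv he hσ, Real.inv_rpow hσ.le, hsub]
    rw [Real.mul_rpow (by linarith) (by positivity), ← Real.rpow_mul hσ.le, ← Real.rpow_neg hσ.le]
    have hexp : σ ^ ((-1 : ℝ) - 1) * σ ^ (-(p * s - 1)) * σ ^ (-(((N : ℝ) - p * s) / p) * p) *
        σ ^ ((N : ℝ) + p * s) = σ ^ (p * s - 1) := by
      rw [← Real.rpow_add hσ, ← Real.rpow_add hσ, ← Real.rpow_add hσ]
      congr 1
      field_simp
      ring
    rw [← hexp, smul_eq_mul, abs_neg, abs_one]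
    ring
  · have hnot : σ⁻¹ ∉ Ioo (0 : ℝ) 1 := fun hm => h ((inv_lt_one₀ hσ).1 hm.2)
    rw [indicator_of_notMem hnot, indicator_of_notMem (show σ ∉ Ioi (1 : ℝ) from h), smul_zero]

lemma hardyIntegrand_nonneg {N : ℕ} {p s : ℝ} (hp : 0 < p) (hps : p * s < N) (e : Euc N) {σ : ℝ}
    (hσ : 1 < σ) : 0 ≤ hardyIntegrand N p s e σ := by
  have hσ0 : 0 < σ := by linarith
  have hone : 0 ≤ σ ^ (((N : ℝ) - p * s) / p) - 1 :=
    sub_nonneg.2 (Real.one_le_rpow hσ.le (div_pos (by linarith) hp).le)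
  have := sphereKernel_nonneg N p s e σ
  unfold hardyIntegrand
  positivity

lemma measurable_hardyIntegrand {N : ℕ} (hN : 2 ≤ N) (p s : ℝ) (e : Euc N) :
    Measurable (hardyIntegrand N p s e) := by
  have := measurable_sphereKernel hN p s e
  unfold hardyIntegrand
  fun_prop

lemma rpow_sub_one_le_mul_sub_one {β σ : ℝ} (hβ : 0 ≤ β) (hσ : 1 < σ) :
    σ ^ β - 1 ≤ β * (σ - 1) * σ ^ β := by
  have hσ0 : 0 < σ := by linarith
  have h1 := Real.add_one_le_exp (-(β * Real.log σ))
  have h2 : σ ^ β * Real.exp (-(β * Real.log σ)) = 1 := by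
    rw [Real.rpow_def_of_pos hσ0, ← Real.exp_add]
    ring_nf
    exact Real.exp_zero
  have h3 := mul_le_mul_of_nonneg_left h1 (show 0 ≤ σ ^ β by positivity)
  rw [h2] at h3
  have h4 : β * Real.log σ * σ ^ β ≤ β * (σ - 1) * σ ^ β := by
    gcongr
    exact Real.log_le_sub_one_of_pos hσ0
  linarith

lemma integrableOn_hardyIntegrand_Ioc {N : ℕ} (hN : 2 ≤ N) {p s : ℝ} (hp : 0 < p) (hs0 : 0 < s)
    (hs1 : s < 1) (hps : p * s < N) {e : Euc N} (he : ‖e‖ = 1) :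
    IntegrableOn (hardyIntegrand N p s e) (Ioc 1 2) := by
  obtain ⟨C, hC0, hC⟩ := exists_sphereKernel_le_near hN (mul_pos hp hs0) he
  set β : ℝ := ((N : ℝ) - p * s) / p with hβdef
  have hβ : 0 < β := div_pos (by linarith) hp
  have hexp : -1 < p - 1 - p * s := by nlinarith
  have hint : IntegrableOn (fun σ : ℝ => C * (2 ^ (p * s) * (β * 2 ^ β) ^ p) *
      (σ - 1) ^ (p - 1 - p * s)) (Ioc 1 2) := by
    have h := (intervalIntegral.intervalIntegrable_rpow' (a := 0) (b := 1) hexp).comp_sub_right 1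
    rw [zero_add, one_add_one_eq_two] at h
    exact (h.const_mul _).1
  refine hint.mono' (measurable_hardyIntegrand hN p s e).aestronglyMeasurable ?_
  filter_upwards [ae_restrict_mem measurableSet_Ioc] with σ ⟨hσ1, hσ2⟩
  have hσ0 : 0 < σ := by linarith
  have hδ : 0 < σ - 1 := by linarith
  rw [Real.norm_of_nonneg (hardyIntegrand_nonneg hp hps e hσ1), hardyIntegrand, ← hβdef]
  have hone : 0 ≤ σ ^ β - 1 := sub_nonneg.2 (Real.one_le_rpow hσ1.le hβ.le)
  have h1 : σ ^ (p * s - 1) ≤ 2 ^ (p * s) :=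
    (Real.rpow_le_rpow_of_exponent_le hσ1.le (by linarith)).trans
      (Real.rpow_le_rpow hσ0.le hσ2 (by positivity))
  have h2 : (σ ^ β - 1) ^ p ≤ (β * 2 ^ β) ^ p * (σ - 1) ^ p := by
    rw [← Real.mul_rpow (by positivity) hδ.le]
    refine Real.rpow_le_rpow hone ((rpow_sub_one_le_mul_sub_one hβ.le hσ1).trans ?_) hp.le
    calc β * (σ - 1) * σ ^ β ≤ β * (σ - 1) * 2 ^ β := by gcongr
      _ = _ := by ring
  calc _ ≤ C * (σ - 1) ^ (-(1 + p * s)) *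
        (2 ^ (p * s) * ((β * 2 ^ β) ^ p * (σ - 1) ^ p)) := by
        gcongr
        exact hC σ hσ1
    _ = C * (2 ^ (p * s) * (β * 2 ^ β) ^ p) * ((σ - 1) ^ (-(1 + p * s)) * (σ - 1) ^ p) := by ring
    _ = _ := by
        rw [← Real.rpow_add hδ]
        ring_nf

lemma integrableOn_hardyIntegrand_Ioi_two {N : ℕ} (hN : 2 ≤ N) {p s : ℝ} (hp : 0 < p)
    (hs0 : 0 < s) (hps : p * s < N) {e : Euc N} (he : ‖e‖ = 1) :
    IntegrableOn (hardyIntegrand N p s e) (Ioi 2) := by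
  have hps0 := mul_pos hp hs0
  obtain ⟨C, hC0, hC⟩ := exists_sphereKernel_le_far hN hps0 he
  set β : ℝ := ((N : ℝ) - p * s) / p with hβdef
  have hβ : 0 < β := div_pos (by linarith) hp
  have hint : IntegrableOn (fun σ : ℝ => C * 2⁻¹ ^ (-((N : ℝ) + p * s)) *
      σ ^ (-1 - p * s)) (Ioi 2) :=
    (integrableOn_Ioi_rpow_of_lt (by linarith) two_pos).const_mul _
  refine hint.mono' (measurable_hardyIntegrand hN p s e).aestronglyMeasurable ?_
  filter_upwards [ae_restrict_mem measurableSet_Ioi] with σ hσ2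
  have hσ2 : 2 < σ := hσ2
  have hσ1 : 1 < σ := by linarith
  have hσ0 : 0 < σ := by linarith
  rw [Real.norm_of_nonneg (hardyIntegrand_nonneg hp hps e hσ1), hardyIntegrand, ← hβdef]
  have hone : 0 ≤ σ ^ β - 1 := sub_nonneg.2 (Real.one_le_rpow hσ1.le hβ.le)
  have h1 : (σ - 1) ^ (-((N : ℝ) + p * s)) ≤ (2⁻¹ * σ) ^ (-((N : ℝ) + p * s)) :=
    Real.rpow_le_rpow_of_nonpos (by positivity) (by linarith)
      (by linarith [N.cast_nonneg (α := ℝ)])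
  rw [Real.mul_rpow (by norm_num) hσ0.le] at h1
  have h2 : (σ ^ β - 1) ^ p ≤ σ ^ ((N : ℝ) - p * s) := by
    rw [show (N : ℝ) - p * s = β * p by rw [hβdef]; field_simp, Real.rpow_mul hσ0.le]
    exact Real.rpow_le_rpow hone (by linarith) hp.le
  calc _ ≤ C * (2⁻¹ ^ (-((N : ℝ) + p * s)) * σ ^ (-((N : ℝ) + p * s))) *
        (σ ^ (p * s - 1) * σ ^ ((N : ℝ) - p * s)) := by
        gcongr
        exact (hC σ hσ1).trans (by gcongr)
    _ = C * 2⁻¹ ^ (-((N : ℝ) + p * s)) *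
        (σ ^ (-((N : ℝ) + p * s)) * σ ^ (p * s - 1) * σ ^ ((N : ℝ) - p * s)) := by ring
    _ = _ := by
        rw [← Real.rpow_add hσ0, ← Real.rpow_add hσ0]
        ring_nf

lemma integrableOn_hardyIntegrand {N : ℕ} (hN : 2 ≤ N) {p s : ℝ} (hp : 0 < p) (hs0 : 0 < s)
    (hs1 : s < 1) (hps : p * s < N) {e : Euc N} (he : ‖e‖ = 1) :
    IntegrableOn (hardyIntegrand N p s e) (Ioi 1) := by
  rw [← Ioc_union_Ioi_eq_Ioi one_le_two]
  exact (integrableOn_hardyIntegrand_Ioc hN hp hs0 hs1 hps he).union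
    (integrableOn_hardyIntegrand_Ioi_two hN hp hs0 hps he)

lemma hardyConst_nonneg (N : ℕ) {p s : ℝ} (hp : 0 < p) (hps : p * s < N) (e : Euc N) :
    0 ≤ hardyConst N p s e := by
  refine setIntegral_nonneg measurableSet_Ioo fun σ hσ => ?_
  have h0 := hσ.1
  have := sphereKernel_nonneg N p s e σ
  have hone : 0 ≤ 1 - σ ^ (((N : ℝ) - p * s) / p) :=
    sub_nonneg.2 (Real.rpow_le_one h0.le hσ.2.le (div_pos (by linarith) hp).le)
  positivity

lemma measurable_psiOneIntegrand {N : ℕ} (hN : 2 ≤ N) (p s γ : ℝ) (e : Euc N) :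
    Measurable (psiOneIntegrand N p s γ e) := by
  have := measurable_sphereKernel hN p s e
  unfold psiOneIntegrand
  fun_prop

lemma psiOneIntegrand_nonneg {N : ℕ} {p s γ : ℝ} (hγ : 0 < γ)
    (h : (N : ℝ) - γ * (p - 1) ≤ p * s) (e : Euc N) {σ : ℝ} (hσ : 1 < σ) :
    0 ≤ psiOneIntegrand N p s γ e σ := by
  have h1 : 0 ≤ σ ^ γ - 1 := sub_nonneg.2 (Real.one_le_rpow hσ.le hγ.le)
  have h2 : 0 ≤ σ ^ (p * s - 1) - σ ^ ((N : ℝ) - 1 - γ * (p - 1)) :=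
    sub_nonneg.2 (Real.rpow_le_rpow_of_exponent_le hσ.le (by linarith))
  have := sphereKernel_nonneg N p s e σ
  unfold psiOneIntegrand
  positivity

lemma psiOneIntegrand_nonpos {N : ℕ} {p s γ : ℝ} (hγ : 0 < γ)
    (h : p * s ≤ (N : ℝ) - γ * (p - 1)) (e : Euc N) {σ : ℝ} (hσ : 1 < σ) :
    psiOneIntegrand N p s γ e σ ≤ 0 := by
  have h1 : 0 ≤ σ ^ γ - 1 := sub_nonneg.2 (Real.one_le_rpow hσ.le hγ.le)
  have h2 : σ ^ (p * s - 1) - σ ^ ((N : ℝ) - 1 - γ * (p - 1)) ≤ 0 :=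
    sub_nonpos.2 (Real.rpow_le_rpow_of_exponent_le hσ.le (by linarith))
  have := sphereKernel_nonneg N p s e σ
  exact mul_nonpos_of_nonneg_of_nonpos (by positivity) h2

lemma neg_psiOneIntegrand_le_hardyIntegrand {N : ℕ} {p s γ : ℝ} (hp : 1 < p) (hγ : 0 < γ)
    (h : p * s ≤ (N : ℝ) - γ * (p - 1)) (e : Euc N) {σ : ℝ} (hσ : 1 < σ) :
    -psiOneIntegrand N p s γ e σ ≤ hardyIntegrand N p s e σ := by
  have hσ0 : 0 < σ := by linarith
  have hp0 : 0 < p := by linarith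
  have key := rpow_sub_one_mul_le hp (Real.one_le_rpow hσ.le hγ.le)
    (Real.one_le_rpow hσ.le (show 0 ≤ (N : ℝ) - p * s - γ * (p - 1) by linarith))
  rw [← Real.rpow_mul hσ0.le, ← Real.rpow_mul hσ0.le, ← Real.rpow_add hσ0,
    show γ * ((p - 1) / p) + ((N : ℝ) - p * s - γ * (p - 1)) * p⁻¹ = ((N : ℝ) - p * s) / p by
      field_simp; ring] at key
  have hsplit : σ ^ ((N : ℝ) - 1 - γ * (p - 1)) =
      σ ^ (p * s - 1) * σ ^ ((N : ℝ) - p * s - γ * (p - 1)) := by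
    rw [← Real.rpow_add hσ0]; ring_nf
  have hK := sphereKernel_nonneg N p s e σ
  calc _ = sphereKernel N p s e σ * (σ ^ (p * s - 1) *
        ((σ ^ γ - 1) ^ (p - 1) * (σ ^ ((N : ℝ) - p * s - γ * (p - 1)) - 1))) := by
        rw [psiOneIntegrand, hsplit]; ring
    _ ≤ _ := by
        unfold hardyIntegrand
        gcongr

lemma integrableOn_psiOneIntegrand {N : ℕ} (hN : 2 ≤ N) {p s γ : ℝ} (hs0 : 0 < s) (hs1 : s < 1)
    (hp : 1 < p) (hps : p * s < N) (hγ : 0 < γ) (h : p * s ≤ (N : ℝ) - γ * (p - 1)) {e : Euc N}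
    (he : ‖e‖ = 1) : IntegrableOn (psiOneIntegrand N p s γ e) (Ioi 1) := by
  refine (integrableOn_hardyIntegrand hN (by linarith) hs0 hs1 hps he).mono'
    (measurable_psiOneIntegrand hN p s γ e).aestronglyMeasurable ?_
  filter_upwards [ae_restrict_mem measurableSet_Ioi] with σ hσ
  rw [Real.norm_of_nonpos (psiOneIntegrand_nonpos hγ h e hσ)]
  exact neg_psiOneIntegrand_le_hardyIntegrand hp hγ h e hσ

lemma theta_eq_integral_neg_psiOneIntegrand (N : ℕ) (p s γ : ℝ) (e : Euc N) :
    theta N p s γ e = ∫ σ in Ioi (1 : ℝ), -psiOneIntegrand N p s γ e σ := by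
  unfold theta psiOneIntegrand
  congr 1
  ext σ
  ring

lemma theta_le_hardyConst {N : ℕ} (hN : 2 ≤ N) {p s γ : ℝ} (hs0 : 0 < s) (hs1 : s < 1)
    (hp : 1 < p) (hps : p * s < N) (hγ : 0 < γ) (h : p * s ≤ (N : ℝ) - γ * (p - 1)) {e : Euc N}
    (he : ‖e‖ = 1) : theta N p s γ e ≤ hardyConst N p s e := by
  rw [theta_eq_integral_neg_psiOneIntegrand, hardyConst_eq_integral_Ioi (by linarith) hps he]
  exact setIntegral_mono_on (integrableOn_psiOneIntegrand hN hs0 hs1 hp hps hγ h he).neg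
    (integrableOn_hardyIntegrand hN (by linarith) hs0 hs1 hps he) measurableSet_Ioi
    fun σ hσ => neg_psiOneIntegrand_le_hardyIntegrand hp hγ h e hσ

lemma psiOneE_eq_neg_theta {N : ℕ} (hN : 2 ≤ N) {p s γ : ℝ} (hs0 : 0 < s) (hs1 : s < 1)
    (hp : 1 < p) (hps : p * s < N) (hγ : 0 < γ) (h : p * s ≤ (N : ℝ) - γ * (p - 1)) {e : Euc N}
    (he : ‖e‖ = 1) : psiOneE N p s γ e = ((-theta N p s γ e : ℝ) : EReal) := by
  have hpos : ∫⁻ σ in Ioi (1 : ℝ), ENNReal.ofReal (psiOneIntegrand N p s γ e σ) = 0 := by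
    rw [setLIntegral_congr_fun (g := fun _ => 0) measurableSet_Ioi fun σ hσ =>
      ENNReal.ofReal_of_nonpos (psiOneIntegrand_nonpos hγ h e hσ)]
    simp
  have hneg_nonneg : ∀ᵐ σ ∂volume.restrict (Ioi (1 : ℝ)), 0 ≤ -psiOneIntegrand N p s γ e σ := by
    filter_upwards [ae_restrict_mem measurableSet_Ioi] with σ hσ
    exact neg_nonneg.2 (psiOneIntegrand_nonpos hγ h e hσ)
  have hneg : ∫⁻ σ in Ioi (1 : ℝ), ENNReal.ofReal (-psiOneIntegrand N p s γ e σ) =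
      ENNReal.ofReal (theta N p s γ e) := by
    rw [theta_eq_integral_neg_psiOneIntegrand]
    exact (ofReal_integral_eq_lintegral_ofReal
      (integrableOn_psiOneIntegrand hN hs0 hs1 hp hps hγ h he).neg hneg_nonneg).symm
  have htheta : 0 ≤ theta N p s γ e := by
    rw [theta_eq_integral_neg_psiOneIntegrand]
    exact integral_nonneg_of_ae hneg_nonneg
  rw [psiOneE, hpos, hneg, EReal.coe_ennreal_ofReal, max_eq_left htheta, EReal.coe_ennreal_zero,
    zero_sub, EReal.coe_neg]

lemma psiOneE_nonneg {N : ℕ} {p s γ : ℝ} (hγ : 0 < γ)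
    (h : (N : ℝ) - γ * (p - 1) ≤ p * s) (e : Euc N) : 0 ≤ psiOneE N p s γ e := by
  have hneg : ∫⁻ σ in Ioi (1 : ℝ), ENNReal.ofReal (-psiOneIntegrand N p s γ e σ) = 0 := by
    rw [setLIntegral_congr_fun (g := fun _ => 0) measurableSet_Ioi fun σ hσ =>
      ENNReal.ofReal_of_nonpos (neg_nonpos.2 (psiOneIntegrand_nonneg hγ h e hσ))]
    simp
  rw [psiOneE, hneg, EReal.coe_ennreal_zero, sub_zero]
  exact EReal.coe_ennreal_nonneg _

/-- **Sign of `Ψ₁(γ̄) + λ` for `γ̄ = ps/(2-p)`, `1 < p < 2`.** If `p < 2N/(N+s)` then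
`γ̄ < (N-ps)/(p-1)` and `Ψ₁(γ̄) = -Θ(γ̄) ≥ -Λ_{N,p,s}`; if `p ≥ 2N/(N+s)` then
`ps ≥ N - γ̄(p-1)` and `Ψ₁(γ̄) ≥ 0` (with `Ψ₁(γ̄)` valued in `(-∞,+∞]`). Consequently,
for every `λ > Λ_{N,p,s}` one has `Ψ₁(γ̄) + λ > 0`. -/
theorem psiOne_plus_lambda_positive (N : ℕ) (hN : 2 ≤ N) (s p : ℝ)
    (hs0 : 0 < s) (hs1 : s < 1) (hp1 : 1 < p) (hp2 : p < 2) (hps : p * s < N)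
    (e : Euc N) (he : ‖e‖ = 1) :
    (p < 2 * N / ((N : ℝ) + s) →
        p * s / (2 - p) < ((N : ℝ) - p * s) / (p - 1) ∧
        psiOneE N p s (p * s / (2 - p)) e =
          ((-theta N p s (p * s / (2 - p)) e : ℝ) : EReal) ∧
        ((-hardyConst N p s e : ℝ) : EReal) ≤ psiOneE N p s (p * s / (2 - p)) e) ∧
    (2 * N / ((N : ℝ) + s) ≤ p →
        (N : ℝ) - (p * s / (2 - p)) * (p - 1) ≤ p * s ∧
        (0 : EReal) ≤ psiOneE N p s (p * s / (2 - p)) e) ∧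
    ∀ lam : ℝ, hardyConst N p s e < lam →
      (0 : EReal) < psiOneE N p s (p * s / (2 - p)) e + (lam : ℝ) := by
  have hp0 : 0 < p := by linarith
  have hγ : 0 < p * s / (2 - p) := div_pos (by positivity) (by linarith)
  have hNs : 0 < (N : ℝ) + s := by positivity
  have h2p : 0 < 2 - p := by linarith
  have hp1' : 0 < p - 1 := by linarith
  have hγeq : p * s / (2 - p) * (2 - p) = p * s := div_mul_cancel₀ _ h2p.ne'
  have hsub : p < 2 * N / ((N : ℝ) + s) → p * s / (2 - p) < ((N : ℝ) - p * s) / (p - 1) := by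
    intro h
    rw [lt_div_iff₀ hNs] at h
    rw [div_lt_div_iff₀ h2p hp1']
    nlinarith
  have hexp : p < 2 * N / ((N : ℝ) + s) → p * s ≤ (N : ℝ) - p * s / (2 - p) * (p - 1) := by
    intro h
    have := (lt_div_iff₀ hp1').1 (hsub h)
    linarith
  have hsup : 2 * N / ((N : ℝ) + s) ≤ p → (N : ℝ) - p * s / (2 - p) * (p - 1) ≤ p * s := by
    intro h
    rw [div_le_iff₀ hNs] at h
    have : p * s / (2 - p) * (p - 1) = p * s / (2 - p) - p * s := by linarith
    rw [this]
    have : (N : ℝ) ≤ p * s / (2 - p) := by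
      rw [le_div_iff₀ h2p]
      linarith
    linarith
  have hlow : p < 2 * N / ((N : ℝ) + s) →
      psiOneE N p s (p * s / (2 - p)) e = ((-theta N p s (p * s / (2 - p)) e : ℝ) : EReal) :=
    fun h => psiOneE_eq_neg_theta hN hs0 hs1 hp1 hps hγ (hexp h) he
  have hle : p < 2 * N / ((N : ℝ) + s) → theta N p s (p * s / (2 - p)) e ≤ hardyConst N p s e :=
    fun h => theta_le_hardyConst hN hs0 hs1 hp1 hps hγ (hexp h) he
  refine ⟨fun h => ⟨hsub h, hlow h, ?_⟩, fun h => ⟨hsup h, psiOneE_nonneg hγ (hsup h) e⟩,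
    fun lam hlam => ?_⟩
  · rw [hlow h, EReal.coe_le_coe_iff]
    exact neg_le_neg (hle h)
  · rcases lt_or_ge p (2 * N / ((N : ℝ) + s)) with h | h
    · rw [hlow h, ← EReal.coe_add, EReal.coe_pos]
      linarith [hle h]
    · have hlam0 : (0 : EReal) < (lam : EReal) :=
        EReal.coe_pos.2 ((hardyConst_nonneg N hp0 hps e).trans_lt hlam)
      exact hlam0.trans_le (le_add_of_nonneg_left (psiOneE_nonneg hγ (hsup h) e))
end
end
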